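/- arXiv:2508.01954 — 11 statements merged into one kernel-verified Lean document; each statement's English description precedes it below -/
import Mathlib

section
/- Let U : ℝ^n → ℝ be continuous and bounded above, and let L(x,v) := (1/2)|v|² − U(x). Define the Mañé critical value c_u(L) := sInf { k ∈ ℝ | for every T > 0 and every C¹ curve γ : [0,T] → ℝ^n, ∫₀^T (L(γ(t), γ̇(t)) + k) dt ≥ 0 }. Then c_u(L) = sup_{x ∈ ℝ^n} U(x), where the supremum is sSup of the range of U. -/
open MeasureTheory intervalIntegral

/-- for `L(x,v) = (1/2)|v|² − U(x)` with `U` continuous and bounded above,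
the Mañé critical value `c_u(L)` equals `sup U`. -/
theorem mane_critical_value_eq_sup {n : ℕ} (U : EuclideanSpace ℝ (Fin n) → ℝ)
    (hUcont : Continuous U) (hUbdd : BddAbove (Set.range U)) :
    sInf {k : ℝ | ∀ T : ℝ, 0 < T → ∀ γ : ℝ → EuclideanSpace ℝ (Fin n), ContDiff ℝ 1 γ →
        0 ≤ ∫ t in (0:ℝ)..T, ((1/2) * ‖deriv γ t‖^2 - U (γ t) + k)}
      = sSup (Set.range U) := by
  apply IsLeast.csInf_eq
  constructor
  · intro T hT γ _
    apply intervalIntegral.integral_nonneg hT.le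
    intro t _
    have h1 : U (γ t) ≤ sSup (Set.range U) := le_csSup hUbdd ⟨γ t, rfl⟩
    have h2 : 0 ≤ (1/2) * ‖deriv γ t‖^2 := by positivity
    linarith
  · intro k hk
    apply csSup_le (Set.range_nonempty U)
    rintro _ ⟨x, rfl⟩
    have h := hk 1 one_pos (fun _ => x) contDiff_const
    simp at h
    linarith
end

section
/- Let U : ℝ^n → ℝ be continuous and bounded above, k ∈ ℝ, τ > 0, and x₋, x₊ ∈ ℝ^n. Then for every T with 0 < T ≤ τ and every C¹ curve x : [0,1] → ℝ^n with x(0) = x₋ and x(1) = x₊, one has T·∫₀¹ [ (1/2)|ẋ(t)|²/T² − U(x(t)) + k ] dt ≥ |x₊ − x₋|²/(2τ) − τ·|k − sup U|, where sup U := sSup(range U). In particular the restricted functional 𝓛_k^{≤τ} is bounded from below for every k ∈ ℝ. -/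
open MeasureTheory intervalIntegral

/-- for `0 < T ≤ τ`, the free-time action satisfies
`𝓛_k(x,T) ≥ |x₊ − x₋|²/(2τ) − τ |k − sup U|`; in particular the restricted functional
`𝓛_k^{≤τ}` is bounded from below for every `k`. -/
theorem restricted_action_bounded_below {n : ℕ} (U : EuclideanSpace ℝ (Fin n) → ℝ)
    (hUcont : Continuous U) (hUbdd : BddAbove (Set.range U)) (k τ : ℝ) (hτ : 0 < τ)
    (xm xp : EuclideanSpace ℝ (Fin n)) :
    ∀ T : ℝ, 0 < T → T ≤ τ →
      ∀ x : ℝ → EuclideanSpace ℝ (Fin n), ContDiff ℝ 1 x → x 0 = xm → x 1 = xp →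
        ‖xp - xm‖^2 / (2 * τ) - τ * |k - sSup (Set.range U)|
          ≤ T * ∫ t in (0:ℝ)..1, ((1/2) * (‖deriv x t‖^2 / T^2) - U (x t) + k) := by
  intro T hT hTτ x hx h0 h1
  set S := sSup (Set.range U) with hS
  have hdc : Continuous (deriv x) := hx.continuous_deriv le_rfl
  have hxc : Continuous x := hx.continuous
  have hd : ‖xp - xm‖ ≤ ∫ t in (0:ℝ)..1, ‖deriv x t‖ := by
    have h : ∫ t in (0:ℝ)..1, deriv x t = xp - xm := by
      rw [← h0, ← h1]
      exact integral_deriv_eq_sub (fun t _ => (hx.differentiable one_ne_zero) t)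
        (hdc.intervalIntegrable _ _)
    rw [← h]
    exact intervalIntegral.norm_integral_le_integral_norm zero_le_one
  set d := ‖xp - xm‖ with hdd
  have hd0 : 0 ≤ d := norm_nonneg _
  have hmono : ∫ t in (0:ℝ)..1, (d / T^2 * ‖deriv x t‖ + (-(d^2 / (2 * T^2)) + (k - S)))
      ≤ ∫ t in (0:ℝ)..1, ((1/2) * (‖deriv x t‖^2 / T^2) - U (x t) + k) := by
    apply intervalIntegral.integral_mono_on zero_le_one
    · exact Continuous.intervalIntegrable (by fun_prop) _ _
    · exact Continuous.intervalIntegrable (by fun_prop) _ _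
    · intro t _
      have hU : U (x t) ≤ S := le_csSup hUbdd ⟨x t, rfl⟩
      have hq : 0 ≤ (‖deriv x t‖ - d)^2 / (2 * T^2) := by positivity
      have he : (‖deriv x t‖ - d)^2 / (2 * T^2) = (1/2) * (‖deriv x t‖^2 / T^2)
          - d / T^2 * ‖deriv x t‖ + d^2 / (2 * T^2) := by
        field_simp
        ring
      linarith
  rw [intervalIntegral.integral_add (Continuous.intervalIntegrable (by fun_prop) _ _)
    (Continuous.intervalIntegrable (by fun_prop) _ _),
    intervalIntegral.integral_const_mul, intervalIntegral.integral_const] at hmono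
  simp only [sub_zero, one_smul] at hmono
  have h2 : d / T^2 * d ≤ d / T^2 * ∫ t in (0:ℝ)..1, ‖deriv x t‖ :=
    mul_le_mul_of_nonneg_left hd (by positivity)
  have h3 := mul_le_mul_of_nonneg_left
    (show d / T^2 * d + (-(d^2 / (2 * T^2)) + (k - S)) ≤ _ from by linarith) hT.le
  refine le_trans ?_ h3
  have h4 : T * (d / T^2 * d + (-(d^2 / (2 * T^2)) + (k - S))) = d^2 / (2 * T) + T * (k - S) := by
    field_simp
    ring
  rw [h4]
  have h5 : d^2 / (2 * τ) ≤ d^2 / (2 * T) := by gcongr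
  have h6 : T * |k - S| ≤ τ * |k - S| := by gcongr
  have h7 : T * (-|k - S|) ≤ T * (k - S) := mul_le_mul_of_nonneg_left (neg_abs_le _) hT.le
  linarith
end

section
/- Let U : ℝ^n → ℝ be continuous and bounded above, k, c ∈ ℝ, and x₋, x₊ ∈ ℝ^n with x₋ ≠ x₊. Then there exists ε > 0 such that for every T > 0 and every C¹ curve x : [0,1] → ℝ^n with x(0) = x₋, x(1) = x₊ and T·∫₀¹ [ (1/2)|ẋ(t)|²/T² − U(x(t)) + k ] dt ≤ c, one has T ≥ ε. That is, the transition time is bounded away from 0 on every sublevel set of the action. -/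
open MeasureTheory intervalIntegral

/-- on every sublevel set of the free-time action the transition time is
bounded away from `0`, provided the endpoints are distinct. -/
theorem time_bounded_away_from_zero {n : ℕ} (U : EuclideanSpace ℝ (Fin n) → ℝ)
    (hUcont : Continuous U) (hUbdd : BddAbove (Set.range U)) (k c : ℝ)
    (xm xp : EuclideanSpace ℝ (Fin n)) (hne : xm ≠ xp) :
    ∃ ε > 0, ∀ T : ℝ, 0 < T →
      ∀ x : ℝ → EuclideanSpace ℝ (Fin n), ContDiff ℝ 1 x → x 0 = xm → x 1 = xp →
        T * (∫ t in (0:ℝ)..1, ((1/2) * (‖deriv x t‖^2 / T^2) - U (x t) + k)) ≤ c →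
          ε ≤ T := by
  obtain ⟨M, hM⟩ := hUbdd
  have hM' : ∀ y, U y ≤ M := fun y => hM ⟨y, rfl⟩
  set d := ‖xp - xm‖ with hd
  have hd0 : 0 < d := norm_pos_iff.2 (sub_ne_zero.2 hne.symm)
  have hB : 0 < 2 * (|c| + |M - k| + 1) := by positivity
  refine ⟨min 1 (d^2 / (2 * (|c| + |M - k| + 1))), by positivity, ?_⟩
  intro T hT x hx h0 h1 hle
  have hdc : Continuous (deriv x) := hx.continuous_deriv le_rfl
  have hxc : Continuous x := hx.continuous
  have hftc : ∫ t in (0:ℝ)..1, deriv x t = xp - xm := by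
    rw [integral_deriv_eq_sub (fun t _ => (hx.differentiable one_ne_zero) t)
      (hdc.intervalIntegrable _ _), h0, h1]
  have hlen : d ≤ ∫ t in (0:ℝ)..1, ‖deriv x t‖ := by
    rw [hd, ← hftc]
    exact norm_integral_le_integral_norm zero_le_one
  have hmono : ∫ t in (0:ℝ)..1, ((d / T^2) * ‖deriv x t‖ + (k - M - d^2 / (2 * T^2)))
      ≤ ∫ t in (0:ℝ)..1, ((1/2) * (‖deriv x t‖^2 / T^2) - U (x t) + k) := by
    apply integral_mono_on zero_le_one
    · exact Continuous.intervalIntegrable (by fun_prop) _ _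
    · exact Continuous.intervalIntegrable (by fun_prop) _ _
    · intro t _
      have h2 : 0 ≤ (‖deriv x t‖ - d)^2 / (2 * T^2) := by positivity
      have h3 : (‖deriv x t‖ - d)^2 / (2 * T^2) = (1/2) * (‖deriv x t‖^2 / T^2)
          - (d / T^2) * ‖deriv x t‖ + d^2 / (2 * T^2) := by
        field_simp
        ring
      have := hM' (x t)
      linarith
  rw [integral_add (Continuous.intervalIntegrable (by fun_prop) _ _)
    (Continuous.intervalIntegrable (by fun_prop) _ _), intervalIntegral.integral_const_mul,
    intervalIntegral.integral_const] at hmono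
  have h4 : (d / T^2) * d ≤ (d / T^2) * ∫ t in (0:ℝ)..1, ‖deriv x t‖ := by gcongr
  simp only [sub_zero, one_smul] at hmono
  have h5 := (mul_le_mul_of_nonneg_left (h4.trans (by linarith : _ ≤
    (∫ t in (0:ℝ)..1, ((1/2) * (‖deriv x t‖^2 / T^2) - U (x t) + k))
      - (k - M - d^2 / (2 * T^2)))) hT.le)
  have h6 : T * (d / T^2 * d) = d^2 / T := by field_simp
  have h7 : T * (d^2 / (2 * T^2)) = d^2 / T / 2 := by field_simp
  have h8 : d^2 / T ≤ 2 * (c + T * (M - k)) := by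
    rw [h6, mul_sub, mul_sub, h7] at h5
    linarith
  rw [div_le_iff₀ hT] at h8
  by_contra! hlt
  have hT1 := hlt.trans_le (min_le_left _ _)
  have hT2 := hlt.trans_le (min_le_right _ _)
  rw [lt_div_iff₀ hB] at hT2
  have h9 : T * (M - k) ≤ |M - k| := by
    nlinarith [le_abs_self (M - k), abs_nonneg (M - k)]
  have h10 : 2 * (c + T * (M - k)) * T ≤ 2 * (|c| + |M - k|) * T := by
    have := le_abs_self c
    gcongr
  nlinarith
end

section
/- Let E be a real Banach space and f : E → ℝ a C² function. Suppose that f is bounded from below and satisfies the Palais–Smale condition: every sequence (x_m) in E such that (f(x_m)) is bounded and ‖Df(x_m)‖ → 0 admits a convergent subsequence. Then f admits a global minimizer, i.e. there exists x* ∈ E with f(x*) ≤ f(x) for all x ∈ E. -/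
theorem ekeland_aux {X : Type*} [MetricSpace X] [CompleteSpace X] (f : X → ℝ)
    (hf : Continuous f) (B : ℝ) (hB : ∀ x, B ≤ f x) (e : ℝ) (he : 0 < e) (x0 : X) :
    ∃ y, f y ≤ f x0 ∧ ∀ z, f y ≤ f z + e * dist y z := by
  have step : ∀ (n : ℕ) (x : X), ∃ y, f y + e * dist x y ≤ f x ∧
      ∀ z, f z + e * dist x z ≤ f x → f y ≤ f z + (1 / 2 : ℝ) ^ n := by
    intro n x
    let T : Set ℝ := f '' {z | f z + e * dist x z ≤ f x}
    have hne : T.Nonempty := ⟨f x, x, by simp, rfl⟩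
    have hb : BddBelow T := ⟨B, by rintro _ ⟨z, _, rfl⟩; exact hB z⟩
    have hlt : sInf T < sInf T + (1 / 2 : ℝ) ^ n := by
      have : (0 : ℝ) < (1 / 2 : ℝ) ^ n := by positivity
      linarith
    obtain ⟨_, ⟨y, hy, rfl⟩, hy2⟩ := exists_lt_of_csInf_lt hne hlt
    refine ⟨y, hy, fun z hz => ?_⟩
    have : sInf T ≤ f z := csInf_le hb ⟨z, hz, rfl⟩
    linarith
  choose g hg1 hg2 using step
  let u : ℕ → X := fun n => Nat.rec x0 (fun n x => g n x) n
  have hu : ∀ n, u (n + 1) = g n (u n) := fun n => rfl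
  have trans : ∀ a b c : X, f b + e * dist a b ≤ f a → f c + e * dist b c ≤ f b →
      f c + e * dist a c ≤ f a := by
    intro a b c h1 h2
    have := mul_le_mul_of_nonneg_left (dist_triangle a b c) he.le
    linarith
  have hS : ∀ n m, n ≤ m → f (u m) + e * dist (u n) (u m) ≤ f (u n) := by
    intro n m h
    induction m, h using Nat.le_induction with
    | base => simp
    | succ m h ih => exact trans _ _ _ ih (by rw [hu]; exact hg1 m (u m))
  have hanti : Antitone (fun n => f (u n)) := by
    intro n m h
    have h1 := hS n m h
    have h2 : 0 ≤ e * dist (u n) (u m) := by positivity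
    show f (u m) ≤ f (u n)
    linarith
  have hlim := tendsto_atTop_ciInf hanti ⟨B, by rintro _ ⟨n, rfl⟩; exact hB _⟩
  have hc : CauchySeq u := by
    rw [Metric.cauchySeq_iff']
    intro d hd
    obtain ⟨N, hN⟩ := Metric.cauchySeq_iff'.1 hlim.cauchySeq (e * d) (by positivity)
    refine ⟨N, fun n hn => ?_⟩
    have h1 := hN n hn
    rw [Real.dist_eq] at h1
    have h2 := hS N n hn
    have h3 := neg_abs_le (f (u n) - f (u N))
    rw [dist_comm]
    exact lt_of_mul_lt_mul_left (by linarith) he.le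
  obtain ⟨y, hy⟩ := cauchySeq_tendsto_of_complete hc
  have hfy : Filter.Tendsto (fun n => f (u n)) Filter.atTop (nhds (f y)) :=
    (hf.tendsto y).comp hy
  have hSy : ∀ n, f y + e * dist (u n) y ≤ f (u n) := by
    intro n
    refine le_of_tendsto (hfy.add ((tendsto_const_nhds.dist hy).const_mul e)) ?_
    filter_upwards [Filter.eventually_ge_atTop n] with m hm using hS n m hm
  refine ⟨y, ?_, fun z => ?_⟩
  · have h1 := hSy 0
    have h2 : 0 ≤ e * dist (u 0) y := by positivity
    have h3 : u 0 = x0 := rfl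
    rw [h3] at h1 h2
    linarith
  · by_contra! hz
    have h1 : ∀ n, f (u (n + 1)) ≤ f z + (1 / 2 : ℝ) ^ n := by
      intro n
      rw [hu]
      exact hg2 n (u n) z (trans _ _ _ (hSy n) hz.le)
    have h2 : f y ≤ f z + 0 :=
      le_of_tendsto_of_tendsto' (hfy.comp (Filter.tendsto_add_atTop_nat 1))
        (tendsto_const_nhds.add
          (tendsto_pow_atTop_nhds_zero_of_lt_one (by norm_num) (by norm_num))) h1
    have h3 : 0 ≤ e * dist y z := by positivity
    linarith

theorem fderiv_norm_aux {E : Type*} [NormedAddCommGroup E] [NormedSpace ℝ E] (f : E → ℝ)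
    (y : E) (hd : DifferentiableAt ℝ f y) (e : ℝ) (he : 0 < e)
    (h : ∀ z, f y ≤ f z + e * dist y z) : ‖fderiv ℝ f y‖ ≤ 2 * e := by
  have h1 := (hasFDerivAt_iff_isLittleO_nhds_zero.1 hd.hasFDerivAt).def he
  obtain ⟨r, hr, hball⟩ := Metric.eventually_nhds_iff_ball.1 h1
  have key : ∀ v ∈ Metric.ball (0 : E) r, -(2 * e * ‖v‖) ≤ fderiv ℝ f y v := by
    intro v hv
    have h2 := hball v hv
    rw [Real.norm_eq_abs] at h2
    have h3 := (abs_le.1 h2).2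
    have h4 := h (y + v)
    rw [dist_self_add_right] at h4
    linarith
  refine ContinuousLinearMap.opNorm_le_of_ball hr (by positivity) fun v hv => ?_
  rw [Real.norm_eq_abs, abs_le]
  refine ⟨key v hv, ?_⟩
  have := key (-v) (by simpa using hv)
  rw [map_neg, norm_neg] at this
  linarith

/-- a `C²` function on a real Banach space which is bounded from below and
satisfies the Palais–Smale condition admits a global minimizer. -/
theorem exists_global_minimizer_of_palais_smale
    {E : Type*} [NormedAddCommGroup E] [NormedSpace ℝ E] [CompleteSpace E]
    (f : E → ℝ) (hf : ContDiff ℝ 2 f)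
    (hbdd : BddBelow (Set.range f))
    (hPS : ∀ x : ℕ → E, (∃ C : ℝ, ∀ m, |f (x m)| ≤ C) →
      Filter.Tendsto (fun m => ‖fderiv ℝ f (x m)‖) Filter.atTop (nhds 0) →
      ∃ φ : ℕ → ℕ, StrictMono φ ∧ ∃ x₀ : E,
        Filter.Tendsto (x ∘ φ) Filter.atTop (nhds x₀)) :
    ∃ xstar : E, ∀ x : E, f xstar ≤ f x := by
  have hc : Continuous f := hf.continuous
  have hB : ∀ x, sInf (Set.range f) ≤ f x := fun x => csInf_le hbdd ⟨x, rfl⟩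
  have ex : ∀ n : ℕ, ∃ y, f y ≤ sInf (Set.range f) + 1 / ((n : ℝ) + 1) ∧
      ‖fderiv ℝ f y‖ ≤ 2 * (1 / ((n : ℝ) + 1)) := by
    intro n
    have hpos : (0 : ℝ) < 1 / ((n : ℝ) + 1) := by positivity
    obtain ⟨_, ⟨x0, rfl⟩, hx0⟩ := exists_lt_of_csInf_lt (Set.range_nonempty f)
      (lt_add_of_pos_right (sInf (Set.range f)) hpos)
    obtain ⟨y, hy1, hy2⟩ := ekeland_aux f hc _ hB _ hpos x0
    exact ⟨y, by linarith,
      fderiv_norm_aux f y ((hf.differentiable (by norm_num)) y) _ hpos hy2⟩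
  choose x hx1 hx2 using ex
  have hlim := tendsto_one_div_add_atTop_nhds_zero_nat (𝕜 := ℝ)
  have hfx : Filter.Tendsto (fun n => f (x n)) Filter.atTop (nhds (sInf (Set.range f))) :=
    tendsto_of_tendsto_of_tendsto_of_le_of_le tendsto_const_nhds
      (by simpa using hlim.const_add (sInf (Set.range f))) (fun n => hB (x n)) hx1
  obtain ⟨C, hC⟩ := (Metric.isBounded_range_of_tendsto _ hfx).exists_norm_le
  obtain ⟨φ, hφ, x₀, hx₀⟩ := hPS x ⟨C, fun m => hC _ ⟨m, rfl⟩⟩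
    (squeeze_zero (fun _ => norm_nonneg _) hx2 (by simpa using hlim.const_mul 2))
  refine ⟨x₀, fun z => ?_⟩
  have := tendsto_nhds_unique ((hc.tendsto x₀).comp hx₀) (hfx.comp hφ.tendsto_atTop)
  rw [this]
  exact hB z
end

section
/- Let U : ℝ^n → ℝ be a C² function bounded above, τ > 0, and x₋, x₊ ∈ ℝ^n. Then there exists a C² curve γ : [0,τ] → ℝ^n with γ(0) = x₋, γ(τ) = x₊, satisfying the Euler–Lagrange equation γ̈(t) = −∇U(γ(t)) for all t ∈ [0,τ], and such that ∫₀^τ ( (1/2)|γ̇(t)|² − U(γ(t)) ) dt ≤ ∫₀^τ ( (1/2)|σ̇(t)|² − U(σ(t)) ) dt for every C¹ curve σ : [0,τ] → ℝ^n with σ(0) = x₋ and σ(τ) = x₊. That is, the fixed-time action admits a minimizer which solves the Euler–Lagrange equation. -/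
open MeasureTheory intervalIntegral



lemma cs_bound {n : ℕ} (σ : ℝ → EuclideanSpace ℝ (Fin n)) (hσ : ContDiff ℝ 1 σ) (a b : ℝ)
    (hab : a ≤ b) : ‖σ b - σ a‖^2 ≤ (b - a) * ∫ t in a..b, ‖deriv σ t‖^2 := by
  rcases hab.eq_or_lt with rfl | hlt
  · simp
  have hd : Continuous (deriv σ) := hσ.continuous_deriv le_rfl
  have hdiff : Differentiable ℝ σ := hσ.differentiable one_ne_zero
  have hpos : 0 < b - a := sub_pos.2 hlt
  set v := σ b - σ a with hv
  set d := b - a with hdd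
  have hI : ∫ t in a..b, inner ℝ v (deriv σ t) = ‖v‖^2 := by
    have := integral_eq_sub_of_hasDerivAt (a := a) (b := b)
      (f := fun t => inner ℝ v (σ t)) (f' := fun t => inner ℝ v (deriv σ t))
      (fun x _ => by
        have := (hasDerivAt_const x v).inner ℝ (hdiff x).hasDerivAt
        simpa using this)
      ((by fun_prop : Continuous _).intervalIntegrable _ _)
    rw [this, ← inner_sub_right, real_inner_self_eq_norm_sq]
  have h0 : ∫ t in a..b, (2 * d * inner ℝ v (deriv σ t) - ‖v‖^2) ≤
      ∫ t in a..b, d^2 * ‖deriv σ t‖^2 := by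
    apply integral_mono_on hab
    · exact (by fun_prop : Continuous _).intervalIntegrable _ _
    · exact (by fun_prop : Continuous _).intervalIntegrable _ _
    · intro x _
      have h1 := real_inner_le_norm v (deriv σ x)
      nlinarith [sq_nonneg (d * ‖deriv σ x‖ - ‖v‖), mul_le_mul_of_nonneg_left h1 hpos.le]
  rw [integral_sub ((by fun_prop : Continuous _).intervalIntegrable _ _)
    ((by fun_prop : Continuous _).intervalIntegrable _ _), intervalIntegral.integral_const_mul,
    intervalIntegral.integral_const_mul, hI, intervalIntegral.integral_const, smul_eq_mul, ← hdd] at h0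
  have : d * ‖v‖^2 ≤ d * (d * ∫ t in a..b, ‖deriv σ t‖^2) := by linarith
  exact le_of_mul_le_mul_left this hpos

lemma taylor {n : ℕ} (U : EuclideanSpace ℝ (Fin n) → ℝ) (hU : ContDiff ℝ 2 U) (K : ℝ)
    (B : Set (EuclideanSpace ℝ (Fin n))) (hB : Convex ℝ B) (hK0 : 0 ≤ K)
    (hK : ∀ x ∈ B, ∀ y ∈ B, ‖gradient U x - gradient U y‖ ≤ K * ‖x - y‖)
    (x y : EuclideanSpace ℝ (Fin n)) (hx : x ∈ B) (hy : y ∈ B) :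
    - U y ≤ - U x - inner ℝ (gradient U x) (y - x) + K * ‖y - x‖^2 := by
  have hd : Differentiable ℝ U := hU.differentiable two_ne_zero
  have hg : ∀ z, InnerProductSpace.toDual ℝ _ (gradient U z) = fderiv ℝ U z := by
    intro z; simp [gradient]
  have hs : segment ℝ x y ⊆ B := hB.segment_subset hx hy
  have := (convex_segment x y).norm_image_sub_le_of_norm_hasFDerivWithin_le' (f := U)
    (f' := fderiv ℝ U) (φ := fderiv ℝ U x) (C := K * ‖y - x‖)
    (fun z _ => (hd z).hasFDerivAt.hasFDerivWithinAt)
    (fun z hz => by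
      rw [← hg, ← hg, ← map_sub, LinearIsometryEquiv.norm_map]
      refine (hK z (hs hz) x hx).trans ?_
      have := norm_sub_le_of_mem_segment hz
      gcongr)
    (left_mem_segment ℝ x y) (right_mem_segment ℝ x y)
  have h2 : fderiv ℝ U x (y - x) = inner ℝ (gradient U x) (y - x) := by
    rw [← hg]; simp
  rw [h2, Real.norm_eq_abs] at this
  have := (abs_le.1 this).1
  nlinarith

lemma key {n : ℕ} (U : EuclideanSpace ℝ (Fin n) → ℝ) (hU : ContDiff ℝ 2 U) (K : ℝ)
    (B : Set (EuclideanSpace ℝ (Fin n))) (hB : Convex ℝ B) (hK0 : 0 ≤ K)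
    (hK : ∀ x ∈ B, ∀ y ∈ B, ‖gradient U x - gradient U y‖ ≤ K * ‖x - y‖)
    (τ : ℝ) (hτ : 0 < τ) (w σ γ : ℝ → EuclideanSpace ℝ (Fin n))
    (hw : ContDiff ℝ 2 w) (hσ : ContDiff ℝ 1 σ)
    (hwg : ∀ t ∈ Set.Icc (0:ℝ) τ, deriv (deriv w) t = - gradient U (γ t))
    (hγB : ∀ t ∈ Set.Icc (0:ℝ) τ, γ t ∈ B)
    (hσB : ∀ t ∈ Set.Icc (0:ℝ) τ, σ t ∈ B)
    (hwB : ∀ t ∈ Set.Icc (0:ℝ) τ, w t ∈ B)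
    (h0 : w 0 = σ 0) (h1 : w τ = σ τ) (δ R : ℝ)
    (hδ : ∀ t ∈ Set.Icc (0:ℝ) τ, ‖γ t - σ t‖ ≤ δ)
    (hR : ∀ t ∈ Set.Icc (0:ℝ) τ, ‖w t - σ t‖ ≤ R)
    (s : ℝ) (hs0 : 0 ≤ s) (hs1 : s ≤ 1) :
    (∫ t in (0:ℝ)..τ, ((1/2) * ‖deriv (fun t => σ t + s • (w t - σ t)) t‖^2
        - U (σ t + s • (w t - σ t)))) ≤
      (∫ t in (0:ℝ)..τ, ((1/2) * ‖deriv σ t‖^2 - U (σ t)))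
      - (s - s^2/2) * (∫ t in (0:ℝ)..τ, ‖deriv (fun t => w t - σ t) t‖^2)
      + τ * (s * (K * δ * R)) 
      + K * s^2 * τ^2 * (∫ t in (0:ℝ)..τ, ‖deriv (fun t => w t - σ t) t‖^2) := by
  have hw1 : ContDiff ℝ 1 w := hw.of_le one_le_two
  have hwd : Differentiable ℝ w := hw1.differentiable one_ne_zero
  have hσd : Differentiable ℝ σ := hσ.differentiable one_ne_zero
  have hw2 : ContDiff ℝ 1 (deriv w) := ((contDiff_succ_iff_deriv (n := 1)).1 hw).2.2
  have hw2d : Differentiable ℝ (deriv w) := hw2.differentiable one_ne_zero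
  have hcσ : Continuous (deriv σ) := hσ.continuous_deriv le_rfl
  have hcw : Continuous (deriv w) := hw1.continuous_deriv le_rfl
  have hcw2 : Continuous (deriv (deriv w)) := hw2.continuous_deriv le_rfl
  have hcU := hU.continuous
  have hcs := hσ.continuous
  have hcww := hw.continuous
  have hde : ∀ t, deriv (fun t => w t - σ t) t = deriv w t - deriv σ t :=
    fun t => ((hwd t).hasDerivAt.sub (hσd t).hasDerivAt).deriv
  have hdm : ∀ t, deriv (fun t => σ t + s • (w t - σ t)) t
      = deriv σ t + s • (deriv w t - deriv σ t) :=
    fun t => ((hσd t).hasDerivAt.add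
      (((hwd t).hasDerivAt.sub (hσd t).hasDerivAt).const_smul s)).deriv
  set D := ∫ t in (0:ℝ)..τ, ‖deriv (fun t => w t - σ t) t‖^2 with hD
  have hE : ∀ t ∈ Set.Icc (0:ℝ) τ, ‖w t - σ t‖^2 ≤ τ * D := by
    intro t ht
    have hc := cs_bound (fun t => w t - σ t) (hw1.sub hσ) 0 t ht.1
    simp only [h0, sub_self, sub_zero] at hc
    have hi : ∀ a b : ℝ, IntervalIntegrable (fun t => ‖deriv (fun t => w t - σ t) t‖^2) volume a b := by
      intro a b
      simp only [hde]
      exact (by fun_prop : Continuous _).intervalIntegrable _ _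
    have h2 := integral_add_adjacent_intervals (hi 0 t) (hi t τ)
    have h3 : 0 ≤ ∫ x in t..τ, ‖deriv (fun t => w t - σ t) x‖^2 :=
      integral_nonneg ht.2 (fun _ _ => by positivity)
    have h4 : 0 ≤ ∫ x in (0:ℝ)..t, ‖deriv (fun t => w t - σ t) x‖^2 :=
      integral_nonneg ht.1 (fun _ _ => by positivity)
    refine hc.trans ?_
    apply mul_le_mul ht.2 _ h4 hτ.le
    rw [hD]; linarith
  have hI : ∫ t in (0:ℝ)..τ, (inner ℝ (deriv w t) (deriv w t - deriv σ t) +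
      inner ℝ (deriv (deriv w) t) (w t - σ t)) = 0 := by
    rw [integral_eq_sub_of_hasDerivAt (f := fun t => inner ℝ (deriv w t) (w t - σ t))
      (fun x _ => (hw2d x).hasDerivAt.inner ℝ ((hwd x).hasDerivAt.sub (hσd x).hasDerivAt))
      ((by fun_prop : Continuous _).intervalIntegrable _ _)]
    simp [h0, h1]
  have hmono : (∫ t in (0:ℝ)..τ, ((1/2) * ‖deriv (fun t => σ t + s • (w t - σ t)) t‖^2
        - U (σ t + s • (w t - σ t)))) ≤
      ∫ t in (0:ℝ)..τ, ((((1/2) * ‖deriv σ t‖^2 - U (σ t)) 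
        - (s - s^2/2) * ‖deriv (fun t => w t - σ t) t‖^2)
        + s * (inner ℝ (deriv w t) (deriv w t - deriv σ t) +
      inner ℝ (deriv (deriv w) t) (w t - σ t)) + (s * (K * δ * R) + K * s^2 * (τ * D))) := by
    simp only [hde, hdm]
    apply integral_mono_on hτ.le
    · exact (by fun_prop : Continuous _).intervalIntegrable _ _
    · exact (by fun_prop : Continuous _).intervalIntegrable _ _
    intro t ht
    have hmid : σ t + s • (w t - σ t) ∈ B := by
      exact hB.add_smul_sub_mem (hσB t ht) (hwB t ht) ⟨hs0, hs1⟩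
    have hT := taylor U hU K B hB hK0 hK (σ t) _ (hσB t ht) hmid
    rw [add_sub_cancel_left, inner_smul_right, norm_smul, Real.norm_eq_abs, abs_of_nonneg hs0] at hT
    have hn : ‖deriv σ t + s • (deriv w t - deriv σ t)‖^2 = ‖deriv σ t‖^2
        + 2 * s * (inner ℝ (deriv w t) (deriv w t - deriv σ t) - ‖deriv w t - deriv σ t‖^2)
        + s^2 * ‖deriv w t - deriv σ t‖^2 := by
      have : inner ℝ (deriv σ t) (deriv w t - deriv σ t) =
          inner ℝ (deriv w t) (deriv w t - deriv σ t) - ‖deriv w t - deriv σ t‖^2 := by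
        rw [← real_inner_self_eq_norm_sq, ← inner_sub_left]; simp
      rw [norm_add_sq_real, inner_smul_right, norm_smul, this, mul_pow, Real.norm_eq_abs, sq_abs]
      ring
    have hg : - inner ℝ (gradient U (σ t)) (w t - σ t) ≤
        inner ℝ (deriv (deriv w) t) (w t - σ t) + K * δ * R := by
      rw [hwg t ht, inner_neg_left]
      have a1 := real_inner_le_norm (gradient U (γ t) - gradient U (σ t)) (w t - σ t)
      have a2 : ‖gradient U (γ t) - gradient U (σ t)‖ * ‖w t - σ t‖ ≤ (K * δ) * R := by
        have := hδ t ht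
        have h5 := hK _ (hγB t ht) _ (hσB t ht)
        have : ‖gradient U (γ t) - gradient U (σ t)‖ ≤ K * δ := h5.trans (by gcongr)
        exact mul_le_mul this (hR t ht) (norm_nonneg _) ((norm_nonneg _).trans this)
      rw [inner_sub_left] at a1
      linarith
    have hg' := mul_le_mul_of_nonneg_left hg hs0
    have hE' := mul_le_mul_of_nonneg_left (hE t ht) (by positivity : 0 ≤ K * s^2)
    rw [hn]
    linarith
  refine hmono.trans (le_of_eq ?_)
  have hi1 : IntervalIntegrable (fun t => (1/2) * ‖deriv σ t‖^2 - U (σ t)) volume 0 τ :=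
    (by fun_prop : Continuous _).intervalIntegrable _ _
  have hi2 : IntervalIntegrable (fun t => (s - s^2/2) * ‖deriv (fun t => w t - σ t) t‖^2) volume 0 τ := by
    simp only [hde]
    exact (by fun_prop : Continuous _).intervalIntegrable _ _
  have hi3 : IntervalIntegrable (fun t => s * (inner ℝ (deriv w t) (deriv w t - deriv σ t) +
      inner ℝ (deriv (deriv w) t) (w t - σ t))) volume 0 τ :=
    (by fun_prop : Continuous _).intervalIntegrable _ _
  rw [integral_add ((hi1.sub hi2).add hi3) (by simp), integral_add (hi1.sub hi2) hi3,
    integral_sub hi1 hi2, intervalIntegral.integral_const_mul, intervalIntegral.integral_const_mul, hI,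
    intervalIntegral.integral_const, ← hD, smul_eq_mul]
  ring

lemma exists_w {n : ℕ} (g : ℝ → EuclideanSpace ℝ (Fin n)) (hg : Continuous g) (τ : ℝ) (hτ : 0 < τ)
    (xm xp : EuclideanSpace ℝ (Fin n)) : ∃ w : ℝ → EuclideanSpace ℝ (Fin n),
    ContDiff ℝ 2 w ∧ w 0 = xm ∧ w τ = xp ∧ ∀ t, deriv (deriv w) t = g t := by
  let G : ℝ → EuclideanSpace ℝ (Fin n) := fun t => ∫ x in (0:ℝ)..t, g x
  have hG : ∀ t, HasDerivAt G (g t) t := fun t => hg.integral_hasStrictDerivAt 0 t |>.hasDerivAt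
  have hGc : Continuous G := continuous_iff_continuousAt.2 fun t => (hG t).continuousAt
  let H : ℝ → EuclideanSpace ℝ (Fin n) := fun t => ∫ x in (0:ℝ)..t, G x
  have hH : ∀ t, HasDerivAt H (G t) t := fun t => hGc.integral_hasStrictDerivAt 0 t |>.hasDerivAt
  let c := (1/τ) • (xp - xm - H τ)
  let w := fun t : ℝ => xm + t • c + H t
  have hw : ∀ t, HasDerivAt w (c + G t) t := fun t => by
    have := (((hasDerivAt_id t).smul_const c).const_add xm).add (hH t)
    rw [one_smul] at this
    exact this
  have hdw : deriv w = fun t => c + G t := funext fun t => (hw t).deriv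
  have hddw : ∀ t, HasDerivAt (deriv w) (g t) t := fun t => by
    rw [hdw]; exact (hG t).const_add c
  have hddw' : deriv (deriv w) = g := funext fun t => (hddw t).deriv
  refine ⟨w, ?_, ?_, ?_, fun t => (hddw t).deriv⟩
  · refine (contDiff_succ_iff_deriv (n := 1)).2 ⟨fun t => (hw t).differentiableAt, by simp, ?_⟩
    refine contDiff_one_iff_deriv.2 ⟨fun t => (hddw t).differentiableAt, ?_⟩
    rw [hddw']; exact hg
  · simp [w, H]
  · simp only [w, c, smul_smul]
    rw [mul_one_div_cancel hτ.ne', one_smul]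
    abel

lemma energy_bound {n : ℕ} (U : EuclideanSpace ℝ (Fin n) → ℝ) (hU : ContDiff ℝ 2 U) (M : ℝ)
    (hM : ∀ x, U x ≤ M) (τ : ℝ) (hτ : 0 < τ) (σ : ℝ → EuclideanSpace ℝ (Fin n))
    (hσ : ContDiff ℝ 1 σ) : ∫ t in (0:ℝ)..τ, ‖deriv σ t‖^2 ≤
      2 * (∫ t in (0:ℝ)..τ, ((1/2) * ‖deriv σ t‖^2 - U (σ t))) + 2 * M * τ := by
  have hd : Continuous (deriv σ) := hσ.continuous_deriv le_rfl
  have hcU := hU.continuous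
  have hcs := hσ.continuous
  have : ∫ t in (0:ℝ)..τ, ‖deriv σ t‖^2 ≤
      ∫ t in (0:ℝ)..τ, (2 * ((1/2) * ‖deriv σ t‖^2 - U (σ t)) + 2 * M) := by
    apply integral_mono_on hτ.le
    · exact (by fun_prop : Continuous _).intervalIntegrable _ _
    · exact (by fun_prop : Continuous _).intervalIntegrable _ _
    intro t _
    linarith [hM (σ t)]
  rw [integral_add ((by fun_prop : Continuous _).intervalIntegrable _ _) (by simp),
    intervalIntegral.integral_const_mul, intervalIntegral.integral_const, smul_eq_mul] at this
  linarith

lemma holder {n : ℕ} (σ : ℝ → EuclideanSpace ℝ (Fin n)) (hσ : ContDiff ℝ 1 σ) (τ C : ℝ)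
    (hC : ∫ t in (0:ℝ)..τ, ‖deriv σ t‖^2 ≤ C) (a b : ℝ) (ha : a ∈ Set.Icc 0 τ)
    (hb : b ∈ Set.Icc 0 τ) : ‖σ a - σ b‖ ≤ √(C * |a - b|) := by
  wlog hab : b ≤ a generalizing a b
  · rw [norm_sub_rev, abs_sub_comm]
    exact this b a hb ha (le_of_not_ge hab)
  apply Real.le_sqrt_of_sq_le
  refine (cs_bound σ hσ b a hab).trans ?_
  have hd : Continuous (deriv σ) := hσ.continuous_deriv le_rfl
  rw [abs_of_nonneg (sub_nonneg.2 hab), mul_comm]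
  refine mul_le_mul_of_nonneg_right (le_trans ?_ hC) (sub_nonneg.2 hab)
  apply integral_mono_interval hb.1 hab ha.2
  · exact Filter.Eventually.of_forall fun _ => by positivity
  · exact (by fun_prop : Continuous _).intervalIntegrable _ _

lemma ascoli {n : ℕ} (τ C : ℝ) (hτ : 0 < τ) (σ : ℕ → ℝ → EuclideanSpace ℝ (Fin n))
    (xm : EuclideanSpace ℝ (Fin n))
    (hσ : ∀ k, ContDiff ℝ 1 (σ k)) (h0 : ∀ k, σ k 0 = xm)
    (hC : ∀ k, ∫ t in (0:ℝ)..τ, ‖deriv (σ k) t‖^2 ≤ C) :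
    ∃ (γ : ℝ → EuclideanSpace ℝ (Fin n)) (φ : ℕ → ℕ) (δ : ℕ → ℝ), Continuous γ ∧
      StrictMono φ ∧ Filter.Tendsto δ Filter.atTop (nhds 0) ∧
      ∀ k, ∀ t ∈ Set.Icc (0:ℝ) τ, ‖γ t - σ (φ k) t‖ ≤ δ k := by
  let F : ℕ → BoundedContinuousFunction (Set.Icc (0:ℝ) τ) (EuclideanSpace ℝ (Fin n)) :=
    fun k => BoundedContinuousFunction.mkOfCompact ⟨fun t => σ k t, by
      have := (hσ k).continuous
      fun_prop⟩
  have hF : ∀ k t, F k t = σ k t := fun k t => rfl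
  have hcomp : IsCompact (closure (Set.range F)) := by
    apply BoundedContinuousFunction.arzela_ascoli
      (Metric.closedBall xm (√(C * τ))) (isCompact_closedBall _ _)
    · rintro f x ⟨k, rfl⟩
      rw [hF, Metric.mem_closedBall, dist_eq_norm, ← h0 k]
      refine (holder (σ k) (hσ k) τ C (hC k) x 0 x.2 ⟨le_rfl, hτ.le⟩).trans ?_
      have hC0 : 0 ≤ C := le_trans (integral_nonneg hτ.le fun _ _ => by positivity) (hC k)
      apply Real.sqrt_le_sqrt
      rw [sub_zero, abs_of_nonneg x.2.1]
      exact mul_le_mul_of_nonneg_left x.2.2 hC0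
    · apply Metric.equicontinuous_of_continuity_modulus (fun d => √(C * d))
      · have : Continuous (fun d => √(C * d)) := by fun_prop
        simpa using this.tendsto 0
      · rintro x y ⟨f, k, rfl⟩
        change dist (σ k x) (σ k y) ≤ _
        rw [dist_eq_norm]
        exact holder (σ k) (hσ k) τ C (hC k) x y x.2 y.2
  obtain ⟨f, -, φ, hφ, hlim⟩ := hcomp.tendsto_subseq (fun k => subset_closure (Set.mem_range_self k))
  refine ⟨Set.IccExtend hτ.le f, φ, fun k => dist (F (φ k)) f, f.continuous.Icc_extend', hφ,
    tendsto_iff_dist_tendsto_zero.1 hlim, ?_⟩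
  intro k t ht
  rw [Set.IccExtend_of_mem _ _ ht, ← dist_eq_norm, dist_comm]
  exact BoundedContinuousFunction.dist_coe_le_dist (f := F (φ k)) (g := f) ⟨t, ht⟩

theorem exists_fixed_time_minimizer {n : ℕ} (U : EuclideanSpace ℝ (Fin n) → ℝ)
    (hU : ContDiff ℝ 2 U) (hUbdd : BddAbove (Set.range U)) (τ : ℝ) (hτ : 0 < τ)
    (xm xp : EuclideanSpace ℝ (Fin n)) :
    ∃ γ : ℝ → EuclideanSpace ℝ (Fin n),
      ContDiff ℝ 2 γ ∧ γ 0 = xm ∧ γ τ = xp ∧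
      (∀ t ∈ Set.Icc (0:ℝ) τ, deriv (deriv γ) t = -gradient U (γ t)) ∧
      ∀ σ : ℝ → EuclideanSpace ℝ (Fin n), ContDiff ℝ 1 σ → σ 0 = xm → σ τ = xp →
        (∫ t in (0:ℝ)..τ, ((1/2) * ‖deriv γ t‖^2 - U (γ t)))
          ≤ ∫ t in (0:ℝ)..τ, ((1/2) * ‖deriv σ t‖^2 - U (σ t)) := by
  obtain ⟨M, hM⟩ := hUbdd
  replace hM : ∀ x, U x ≤ M := fun x => hM (Set.mem_range_self x)
  let A : (ℝ → EuclideanSpace ℝ (Fin n)) → ℝ :=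
    fun σ => ∫ t in (0:ℝ)..τ, ((1/2) * ‖deriv σ t‖^2 - U (σ t))
  let S : Set ℝ := A '' {σ | ContDiff ℝ 1 σ ∧ σ 0 = xm ∧ σ τ = xp}
  have hSne : S.Nonempty := by
    obtain ⟨w, h1, h2, h3, -⟩ := exists_w (fun _ => 0) continuous_const τ hτ xm xp
    exact ⟨A w, w, ⟨h1.of_le one_le_two, h2, h3⟩, rfl⟩
  have hSb : BddBelow S := by
    refine ⟨-(M * τ), ?_⟩
    rintro _ ⟨σ, ⟨h1, -, -⟩, rfl⟩
    have := energy_bound U hU M hM τ hτ σ h1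
    have h3 : 0 ≤ ∫ t in (0:ℝ)..τ, ‖deriv σ t‖^2 := integral_nonneg hτ.le fun _ _ => by positivity
    change _ ≤ ∫ t in (0:ℝ)..τ, ((1/2) * ‖deriv σ t‖^2 - U (σ t))
    linarith
  obtain ⟨u, hanti, hulim, huS⟩ := exists_seq_tendsto_sInf hSne hSb
  set m := sInf S with hm
  have hmle : ∀ σ, ContDiff ℝ 1 σ → σ 0 = xm → σ τ = xp → m ≤ A σ :=
    fun σ h1 h2 h3 => csInf_le hSb ⟨σ, ⟨h1, h2, h3⟩, rfl⟩
  choose σ hσ hσu using huS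
  obtain ⟨γ, φ, δ, hγ, hφ, hδ, hγσ⟩ := ascoli τ (2 * u 0 + 2 * M * τ) hτ σ xm (fun k => (hσ k).1)
    (fun k => (hσ k).2.1) (fun k => by
      have := energy_bound U hU M hM τ hτ (σ k) (hσ k).1
      have h2 : A (σ k) ≤ u 0 := (hσu k).trans_le (hanti (Nat.zero_le k))
      change _ ≤ 2 * A (σ k) + _ at this
      linarith)
  have hgr : ContDiff ℝ 1 (gradient U) :=
    (InnerProductSpace.toDual ℝ (EuclideanSpace ℝ (Fin n))).symm.contDiff.comp
      (hU.fderiv_right (m := 1) (by norm_num))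
  obtain ⟨w, hw, hw0, hw1, hwg⟩ := exists_w (fun t => - gradient U (γ t))
    (hgr.continuous.comp hγ).neg τ hτ xm xp
  -- bounds
  obtain ⟨d, hd⟩ : ∃ d, ∀ k, δ k ≤ d := by
    obtain ⟨d, hd⟩ := hδ.bddAbove_range
    exact ⟨d, fun k => hd (Set.mem_range_self k)⟩
  obtain ⟨Rγ, hRγ⟩ := isCompact_Icc.exists_bound_of_continuousOn (s := Set.Icc 0 τ) hγ.continuousOn
  obtain ⟨Rw, hRw⟩ := isCompact_Icc.exists_bound_of_continuousOn (s := Set.Icc 0 τ)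
    hw.continuous.continuousOn
  have h0mem : (0:ℝ) ∈ Set.Icc 0 τ := ⟨le_rfl, hτ.le⟩
  have hδ0 : ∀ k, 0 ≤ δ k := fun k => (norm_nonneg _).trans (hγσ k 0 h0mem)
  have hd0 : 0 ≤ d := (hδ0 0).trans (hd 0)
  have hRγ0 : 0 ≤ Rγ := (norm_nonneg _).trans (hRγ 0 h0mem)
  have hRw0 : 0 ≤ Rw := (norm_nonneg _).trans (hRw 0 h0mem)
  set R := Rγ + d + Rw with hR
  have hRσ : ∀ k, ∀ t ∈ Set.Icc (0:ℝ) τ, ‖σ (φ k) t‖ ≤ Rγ + d := by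
    intro k t ht
    have h1 := hγσ k t ht
    have h2 := norm_sub_norm_le (σ (φ k) t) (γ t)
    rw [norm_sub_rev] at h2
    linarith [hd k, hRγ t ht]
  obtain ⟨K, hK⟩ := (hgr.locallyLipschitz.locallyLipschitzOn
    (s := Metric.closedBall 0 R)).exists_lipschitzOnWith_of_compact (isCompact_closedBall _ _)
  have hK' : ∀ x ∈ Metric.closedBall (0 : EuclideanSpace ℝ (Fin n)) R,
      ∀ y ∈ Metric.closedBall (0 : EuclideanSpace ℝ (Fin n)) R,
      ‖gradient U x - gradient U y‖ ≤ K * ‖x - y‖ := fun x hx y hy => by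
    simpa [dist_eq_norm] using hK.dist_le_mul x hx y hy
  let D : ℕ → ℝ := fun k => ∫ t in (0:ℝ)..τ, ‖deriv (fun t => w t - σ (φ k) t) t‖^2
  have hD0 : ∀ k, 0 ≤ D k := fun k => integral_nonneg hτ.le fun _ _ => by positivity
  have hkey : ∀ k, ∀ s : ℝ, 0 ≤ s → s ≤ 1 →
      A (fun t => σ (φ k) t + s • (w t - σ (φ k) t)) ≤ u (φ k) - (s - s^2/2) * D k
        + τ * (s * (K * δ k * R)) + K * s^2 * τ^2 * D k := by
    intro k s hs0 hs1
    rw [← hσu]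
    refine key U hU K _ (convex_closedBall 0 R) K.2 hK' τ hτ w (σ (φ k)) γ hw (hσ _).1
      (fun t _ => hwg t) ?_ ?_ ?_ (by rw [hw0, (hσ _).2.1]) (by rw [hw1, (hσ _).2.2]) (δ k) R
      (hγσ k) ?_ s hs0 hs1
    · intro t ht
      rw [mem_closedBall_zero_iff]; linarith [hRγ t ht]
    · intro t ht
      rw [mem_closedBall_zero_iff]; linarith [hRσ k t ht]
    · intro t ht
      rw [mem_closedBall_zero_iff]; linarith [hRw t ht]
    · intro t ht
      linarith [norm_sub_le (w t) (σ (φ k) t), hRσ k t ht, hRw t ht]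
  have hulim' : Filter.Tendsto (fun k => u (φ k)) Filter.atTop (nhds m) :=
    hulim.comp hφ.tendsto_atTop
  have hKn : (0:ℝ) ≤ K := K.2
  have hDlim : Filter.Tendsto D Filter.atTop (nhds 0) := by
    set s : ℝ := 1 / (2 + 4 * K * τ^2) with hs
    have hden : (0:ℝ) < 2 + 4 * K * τ^2 := by positivity
    have hs0 : 0 < s := by positivity
    have hs2 : s * (2 + 4 * K * τ^2) = 1 := by rw [hs]; field_simp
    have hs1 : s ≤ 1/2 := by nlinarith [mul_nonneg hs0.le (by positivity : 0 ≤ K * τ^2)]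
    have hs3 : s * (K * τ^2) ≤ 1/4 := by nlinarith
    have hub : ∀ k, D k ≤ (2/s) * (u (φ k) - m + τ * (s * (K * δ k * R))) := by
      intro k
      have h1 := hkey k s hs0.le (by linarith)
      have h2 := hmle (fun t => σ (φ k) t + s • (w t - σ (φ k) t))
        ((hσ _).1.add (((hw.of_le one_le_two).sub (hσ _).1).const_smul s))
        (by simp [hw0, (hσ (φ k)).2.1]) (by simp [hw1, (hσ (φ k)).2.2])
      have h3 : s / 2 * D k ≤ (s - s^2/2 - K * s^2 * τ^2) * D k := by
        apply mul_le_mul_of_nonneg_right _ (hD0 k)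
        nlinarith
      have h4 : s / 2 * D k ≤ u (φ k) - m + τ * (s * (K * δ k * R)) := by linarith
      calc D k = (2/s) * (s / 2 * D k) := by field_simp
        _ ≤ _ := by gcongr
    refine squeeze_zero hD0 hub ?_
    have := ((hulim'.sub_const m).add
      ((((hδ.const_mul (K:ℝ)).mul_const R).const_mul s).const_mul τ)).const_mul (2/s)
    simpa using this
  have hwγ : ∀ t ∈ Set.Icc (0:ℝ) τ, γ t = w t := by
    intro t ht
    have hb : ∀ k, ‖γ t - w t‖ ≤ δ k + √(D k * |t - 0|) := by
      intro k
      have h1 := hγσ k t ht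
      have h2 := holder (fun t => w t - σ (φ k) t) ((hw.of_le one_le_two).sub (hσ _).1) τ (D k)
        le_rfl t 0 ht h0mem
      simp only [hw0, (hσ (φ k)).2.1, sub_self, sub_zero] at h2
      rw [sub_zero]
      have h3 := norm_sub_le_norm_sub_add_norm_sub (γ t) (σ (φ k) t) (w t)
      rw [norm_sub_rev (σ (φ k) t)] at h3
      linarith
    have hl : Filter.Tendsto (fun k => δ k + √(D k * |t - 0|)) Filter.atTop (nhds 0) := by
      have := hδ.add ((hDlim.mul_const |t - 0|).sqrt)
      simpa using this
    have := ge_of_tendsto' hl hb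
    rw [← sub_eq_zero, ← norm_le_zero_iff]
    exact this
  refine ⟨w, hw, hw0, hw1, fun t ht => by rw [hwg, hwγ t ht], ?_⟩
  have hAw : A w ≤ m := by
    have hub : ∀ k, A w ≤ u (φ k) - (1 - 1^2/2) * D k
        + τ * (1 * (K * δ k * R)) + K * 1^2 * τ^2 * D k := by
      intro k
      have := hkey k 1 zero_le_one le_rfl
      simpa only [one_smul, add_sub_cancel] using this
    refine ge_of_tendsto' (x := Filter.atTop) ?_ hub
    have := ((hulim'.sub (hDlim.const_mul (1 - 1^2/2))).add
      ((((hδ.const_mul (K:ℝ)).mul_const R).const_mul 1).const_mul τ)).add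
        (hDlim.const_mul (K * 1^2 * τ^2 : ℝ))
    simpa using this
  intro σ' h1 h2 h3
  exact hAw.trans (hmle σ' h1 h2 h3)
end

section
/- Let U : ℝ^n → ℝ be C¹, k ∈ ℝ, τ > 0, x₋, x₊ ∈ ℝ^n, and define k₀ := sInf { k' ∈ ℝ | there exists a connected set S ⊆ ℝ^n × ℝ^n with S ⊆ H⁻¹({k'}), S ∩ ({x₋} × ℝ^n) ≠ ∅ and S ∩ ({x₊} × ℝ^n) ≠ ∅ }, where H(q,p) := (1/2)|p|² + U(q). Suppose (x,T) with 0 < T < τ is a critical point of the free-time action, i.e. x : [0,1] → ℝ^n is C² with x(0) = x₋, x(1) = x₊, satisfies the rescaled Euler–Lagrange equation ẍ(t) = −T²·∇U(x(t)) for all t ∈ [0,1], and ∫₀¹ [ k − ( (1/2)|ẋ(t)/T|² + U(x(t)) ) ] dt = 0. Then k ≥ k₀. -/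
open MeasureTheory intervalIntegral

/-- if `(x,T)` with `0 < T < τ` is a critical point of the free-time
action (Euler–Lagrange equation plus vanishing of the `T`-derivative), then the energy
parameter `k` is at least the critical value `k₀(L; x₋, x₊)` defined via connected subsets
of level sets of the Hamiltonian `H(q,p) = (1/2)|p|² + U(q)` meeting both fibers over the
endpoints. -/
theorem critical_point_energy_ge_k0 {n : ℕ} (U : EuclideanSpace ℝ (Fin n) → ℝ)
    (hU : ContDiff ℝ 1 U) (k τ : ℝ) (hτ : 0 < τ)
    (xm xp : EuclideanSpace ℝ (Fin n))
    (k₀ : ℝ)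
    (hk₀ : k₀ = sInf {k' : ℝ |
      ∃ S : Set (EuclideanSpace ℝ (Fin n) × EuclideanSpace ℝ (Fin n)),
        IsConnected S ∧
        S ⊆ {qp | (1/2) * ‖qp.2‖^2 + U qp.1 = k'} ∧
        (S ∩ {qp | qp.1 = xm}).Nonempty ∧ (S ∩ {qp | qp.1 = xp}).Nonempty})
    (T : ℝ) (hT0 : 0 < T) (hTτ : T < τ)
    (x : ℝ → EuclideanSpace ℝ (Fin n)) (hx : ContDiff ℝ 2 x)
    (hx0 : x 0 = xm) (hx1 : x 1 = xp)
    (hEL : ∀ t ∈ Set.Icc (0:ℝ) 1, deriv (deriv x) t = -(T^2) • gradient U (x t))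
    (hcrit : ∫ t in (0:ℝ)..1,
        (k - ((1/2) * (‖deriv x t‖^2 / T^2) + U (x t))) = 0) :
    k₀ ≤ k := by
  have hd : ContDiff ℝ 1 (deriv x) := by
    have h2 : ContDiff ℝ (1 + 1) x := by
      have : (1 + 1 : WithTop ℕ∞) = 2 := by norm_num
      rw [this]; exact hx
    exact (contDiff_succ_iff_deriv.1 h2).2.2
  have hxd : ∀ t, HasDerivAt x (deriv x t) t := fun t =>
    ((hx.differentiable (by norm_num)) t).hasDerivAt
  have hdd : ∀ t, HasDerivAt (deriv x) (deriv (deriv x) t) t := fun t =>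
    ((hd.differentiable (by norm_num)) t).hasDerivAt
  set e : ℝ → ℝ := fun t => (1/2) * (‖deriv x t‖^2 / T^2) + U (x t) with he
  have hUd : ∀ t, HasDerivAt (fun s => U (x s)) (inner ℝ (gradient U (x t)) (deriv x t)) t := by
    intro t
    have h1 : HasGradientAt U (gradient U (x t)) (x t) :=
      ((hU.differentiable (by norm_num)) (x t)).hasGradientAt
    have h2 := h1.hasFDerivAt.comp_hasDerivAt t (hxd t)
    exact h2.congr_deriv (by simp)
  have hed : ∀ t ∈ Set.Icc (0:ℝ) 1, HasDerivAt e 0 t := by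
    intro t ht
    have h := ((((hdd t).norm_sq).div_const (T^2)).const_mul (1/2 : ℝ)).add (hUd t)
    refine h.congr_deriv ?_
    rw [hEL t ht, inner_smul_right, real_inner_comm]
    field_simp
    ring
  have hconst : ∀ t ∈ Set.Icc (0:ℝ) 1, e t = e 0 :=
    constant_of_has_deriv_right_zero (fun t ht => (hed t ht).continuousAt.continuousWithinAt)
      (fun t ht => (hed t (Set.Ico_subset_Icc_self ht)).hasDerivWithinAt)
  have hk : e 0 = k := by
    have h1 : ∫ t in (0:ℝ)..1, (k - e t) = ∫ t in (0:ℝ)..1, (k - e 0) := by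
      apply intervalIntegral.integral_congr
      intro t ht
      rw [Set.uIcc_of_le zero_le_one] at ht
      simp only [hconst t ht]
    have h2 : ∫ t in (0:ℝ)..1, (k - e t) = 0 := hcrit
    rw [h2, intervalIntegral.integral_const] at h1
    simp only [sub_zero, one_smul] at h1
    linarith
  rw [hk₀]
  apply csInf_le
  · refine ⟨U xm, ?_⟩
    rintro k' ⟨S, -, hS, ⟨⟨q, p⟩, hq, hqm⟩, -⟩
    have h1 := hS hq
    simp only [Set.mem_ofPred_eq] at h1 hqm
    rw [hqm] at h1
    nlinarith [sq_nonneg ‖p‖]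
  · refine ⟨(fun t => (x t, T⁻¹ • deriv x t)) '' Set.Icc (0:ℝ) 1, ?_, ?_, ?_, ?_⟩
    · refine (isConnected_Icc zero_le_one).image _ (Continuous.continuousOn ?_)
      have h1 := hx.continuous
      have h2 := hd.continuous
      fun_prop
    · rintro _ ⟨t, ht, rfl⟩
      have h1 := hconst t ht
      rw [hk] at h1
      simp only [Set.mem_ofPred_eq]
      rw [← h1, he, norm_smul, mul_pow, norm_inv, Real.norm_of_nonneg hT0.le]
      simp only
      field_simp
    · exact ⟨_, ⟨0, by simp, rfl⟩, hx0⟩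
    · exact ⟨_, ⟨1, by simp, rfl⟩, hx1⟩
end

section
/- Let E be a real Hilbert space, A : E → E a bounded self-adjoint operator (⟨Au,v⟩ = ⟨u,Av⟩ for all u,v), and w ∈ E. Let ℓ : E → ℝ be the continuous linear functional ℓ(v) := −⟨Aw,v⟩, set H := ker ℓ and H⊥ := { u ∈ E : ⟨Au,v⟩ = 0 for all v ∈ H }. Then H⊥ = ker A + span{w} (as submodules of E), and ker A ⊆ H. -/
open scoped RealInnerProductSpace

variable {E : Type*} [NormedAddCommGroup E] [InnerProductSpace ℝ E] [CompleteSpace E]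

/-- The linear functional `ℓ(v) = −⟨Aw, v⟩`. -/
noncomputable def ellFunctional (A : E →L[ℝ] E) (w : E) : E →L[ℝ] ℝ :=
  -(InnerProductSpace.toDual ℝ E (A w) : E →L[ℝ] ℝ)

/-- The subspace `H⊥ = { u | ⟨Au, v⟩ = 0 for all v ∈ H }` of vectors `A`-orthogonal to a
subspace `H`. -/
def aOrthogonal (A : E →L[ℝ] E) (H : Submodule ℝ E) : Submodule ℝ E where
  carrier := {u | ∀ v ∈ H, ⟪A u, v⟫ = 0}
  add_mem' := by
    intro a b ha hb v hv
    rw [map_add, inner_add_left, ha v hv, hb v hv, add_zero]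
  zero_mem' := by
    intro v hv
    rw [map_zero, inner_zero_left]
  smul_mem' := by
    intro c a ha v hv
    rw [map_smul, real_inner_smul_left, ha v hv, mul_zero]

/-- with `ℓ(v) = −⟨Aw,v⟩`, `H = ker ℓ` and `H⊥` the set of vectors
`A`-orthogonal to `H`, one has `H⊥ = ker A + span{w}` and `ker A ⊆ H`, for any bounded
self-adjoint operator `A` on a real Hilbert space. -/
theorem aOrthogonal_eq_ker_sup_span (A : E →L[ℝ] E)
    (hA : ∀ u v : E, ⟪A u, v⟫ = ⟪u, A v⟫) (w : E) :
    aOrthogonal A (LinearMap.ker (ellFunctional A w : E →ₗ[ℝ] ℝ))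
        = LinearMap.ker (A : E →ₗ[ℝ] E) ⊔ Submodule.span ℝ {w} ∧
      LinearMap.ker (A : E →ₗ[ℝ] E) ≤ LinearMap.ker (ellFunctional A w : E →ₗ[ℝ] ℝ) := by
  have hmem : ∀ v : E, v ∈ LinearMap.ker (ellFunctional A w : E →ₗ[ℝ] ℝ) ↔ ⟪A w, v⟫ = 0 := by
    intro v
    simp [ellFunctional]
  refine ⟨le_antisymm ?_ (sup_le ?_ ?_), ?_⟩
  · intro u hu
    have hu' : ∀ v : E, ⟪A w, v⟫ = 0 → ⟪A u, v⟫ = 0 := fun v hv => hu v ((hmem v).2 hv)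
    obtain ⟨c, hc⟩ : ∃ c : ℝ, ⟪A w, A u - c • A w⟫ = 0 := by
      by_cases h : A w = 0
      · exact ⟨0, by simp [h]⟩
      · refine ⟨⟪A w, A u⟫ / ⟪A w, A w⟫, ?_⟩
        have h2 : ⟪A w, A w⟫ ≠ 0 := inner_self_ne_zero.2 h
        rw [inner_sub_right, real_inner_smul_right, div_mul_cancel₀ _ h2, sub_self]
    have h0 : A u - c • A w = 0 := by
      rw [← inner_self_eq_zero (𝕜 := ℝ)]
      nth_rewrite 1 [inner_sub_left]
      rw [real_inner_smul_left, hc, hu' _ hc]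
      simp
    refine Submodule.mem_sup.2 ⟨u - c • w, ?_, c • w, ?_, by simp⟩
    · simpa using h0
    · exact Submodule.smul_mem _ _ (Submodule.mem_span_singleton_self w)
  · intro u hu v _
    have hu0 : A u = 0 := by simpa using hu
    rw [hu0, inner_zero_left]
  · rw [Submodule.span_singleton_le_iff_mem]
    exact fun v hv => (hmem v).1 hv
  · intro u hu
    have hu0 : A u = 0 := by simpa using hu
    rw [hmem, hA, hu0, inner_zero_right]
end

section
/- Let E be a real Hilbert space, A : E → E a bounded self-adjoint operator (⟨Au,v⟩ = ⟨u,Av⟩ for all u,v) with finite-dimensional kernel, and w ∈ E. Let ℓ : E → ℝ be the continuous linear functional ℓ(v) := −⟨Aw,v⟩, set H := ker ℓ, H⊥ := { u ∈ E : ⟨Au,v⟩ = 0 for all v ∈ H }, a := ℓ(w) = −⟨Aw,w⟩, and 𝔫 := m⁻((u,v) ↦ ⟨Au,v⟩ restricted to H⊥) + dim(H ∩ H⊥) − dim(H ∩ ker A). Then 𝔫 ∈ {0,1}; moreover, if a > 0 then 𝔫 = 1, and if a < 0 then 𝔫 = 0. -/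
open scoped RealInnerProductSpace

variable {E : Type*} [NormedAddCommGroup E] [InnerProductSpace ℝ E] [CompleteSpace E]

/-- The Morse index of a bilinear form `B` restricted to a subspace `S`: the supremum (in
`ℕ∞`) of the dimensions of finite-dimensional subspaces of `S` on which `B` is negative
definite. -/
noncomputable def morseIndexOn {F : Type*} [AddCommGroup F] [Module ℝ F]
    (B : F → F → ℝ) (S : Submodule ℝ F) : ℕ∞ :=
  sSup {d : ℕ∞ | ∃ W : Submodule ℝ F, W ≤ S ∧ FiniteDimensional ℝ W ∧
    (Module.finrank ℝ W : ℕ∞) = d ∧ ∀ u ∈ W, u ≠ 0 → B u u < 0}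

/-- The `{0,1}`-valued correction term
`𝔫 = m⁻(⟨A·,·⟩|_{H⊥}) + dim(H ∩ H⊥) − dim(H ∩ ker A)`. -/
noncomputable def nCorrection (A : E →L[ℝ] E) (w : E) : ℕ∞ :=
  morseIndexOn (fun u v => ⟪A u, v⟫)
      (aOrthogonal A (LinearMap.ker (ellFunctional A w : E →ₗ[ℝ] ℝ)))
    + (Module.finrank ℝ
        ↥(LinearMap.ker (ellFunctional A w : E →ₗ[ℝ] ℝ) ⊓
            aOrthogonal A (LinearMap.ker (ellFunctional A w : E →ₗ[ℝ] ℝ))) : ℕ∞)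
    - (Module.finrank ℝ
        ↥(LinearMap.ker (ellFunctional A w : E →ₗ[ℝ] ℝ) ⊓ LinearMap.ker (A : E →ₗ[ℝ] E)) : ℕ∞)

theorem aux_mem_H (A : E →L[ℝ] E) (w v : E) :
    v ∈ LinearMap.ker (ellFunctional A w : E →ₗ[ℝ] ℝ) ↔ ⟪A w, v⟫ = 0 := by
  simp [ellFunctional]

theorem aux_perp (A : E →L[ℝ] E) (hA : ∀ u v : E, ⟪A u, v⟫ = ⟪u, A v⟫) (w : E) :
    aOrthogonal A (LinearMap.ker (ellFunctional A w : E →ₗ[ℝ] ℝ)) =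
      LinearMap.ker (A : E →ₗ[ℝ] E) ⊔ Submodule.span ℝ {w} := by
  ext u
  constructor
  · intro hu
    have hu' : ∀ v, ⟪A w, v⟫ = 0 → ⟪A u, v⟫ = 0 := fun v hv => hu v ((aux_mem_H A w v).2 hv)
    set c := ⟪A w, A u⟫ / ⟪A w, A w⟫ with hc
    have h1 : ⟪A w, A u - c • A w⟫ = 0 := by
      rw [inner_sub_right, real_inner_smul_right]
      by_cases h : A w = 0
      · simp [h]
      · have : ⟪A w, A w⟫ ≠ 0 := by simpa using h
        rw [hc]; field_simp; ring
    have h2 := hu' _ h1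
    have h3 : ⟪A u - c • A w, A u - c • A w⟫ = 0 := by
      rw [inner_sub_left (A u), real_inner_smul_left, h1, h2]; ring
    rw [inner_self_eq_zero] at h3
    refine Submodule.mem_sup.2 ⟨u - c • w, ?_, c • w, ?_, by simp⟩
    · simpa using h3
    · exact Submodule.smul_mem _ _ (Submodule.mem_span_singleton_self w)
  · intro hu v hv
    rw [aux_mem_H] at hv
    obtain ⟨k, hk, y, hy, rfl⟩ := Submodule.mem_sup.1 hu
    obtain ⟨c, rfl⟩ := Submodule.mem_span_singleton.1 hy
    have hk : A k = 0 := hk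
    rw [map_add, map_smul, hk, zero_add, real_inner_smul_left, hv, mul_zero]

theorem aux_quad (A : E →L[ℝ] E) (hA : ∀ u v : E, ⟪A u, v⟫ = ⟪u, A v⟫) (w k : E) (c : ℝ)
    (hk : A k = 0) : ⟪A (k + c • w), k + c • w⟫ = c ^ 2 * ⟪A w, w⟫ := by
  have : ⟪A w, k⟫ = 0 := by rw [hA, hk, inner_zero_right]
  rw [map_add, map_smul, hk, zero_add, real_inner_smul_left, inner_add_right,
    real_inner_smul_right, this]
  ring

theorem aux_morse_zero (A : E →L[ℝ] E) (hA : ∀ u v : E, ⟪A u, v⟫ = ⟪u, A v⟫) (w : E)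
    (h : 0 ≤ ⟪A w, w⟫) :
    morseIndexOn (fun u v => ⟪A u, v⟫)
      (LinearMap.ker (A : E →ₗ[ℝ] E) ⊔ Submodule.span ℝ {w}) = 0 := by
  unfold morseIndexOn
  rw [← nonpos_iff_eq_zero]
  apply sSup_le
  rintro d ⟨W, hW, -, rfl, hneg⟩
  have : W = ⊥ := by
    rw [Submodule.eq_bot_iff]
    intro u hu
    by_contra hu0
    have := hneg u hu hu0
    obtain ⟨k, hk, y, hy, rfl⟩ := Submodule.mem_sup.1 (hW hu)
    obtain ⟨c, rfl⟩ := Submodule.mem_span_singleton.1 hy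
    simp only [aux_quad A hA w k c hk] at this
    nlinarith [mul_nonneg (sq_nonneg c) h]
  subst this
  simp

theorem aux_morse_one (A : E →L[ℝ] E)
    (hker : FiniteDimensional ℝ (LinearMap.ker (A : E →ₗ[ℝ] E))) (w : E)
    (h : ⟪A w, w⟫ < 0) :
    morseIndexOn (fun u v => ⟪A u, v⟫)
      (LinearMap.ker (A : E →ₗ[ℝ] E) ⊔ Submodule.span ℝ {w}) = 1 := by
  have hw : w ≠ 0 := by rintro rfl; simp at h
  unfold morseIndexOn
  apply le_antisymm
  · apply sSup_le
    rintro d ⟨W, hW, hfin, rfl, hneg⟩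
    have hb : W ⊓ LinearMap.ker (A : E →ₗ[ℝ] E) = ⊥ := by
      rw [Submodule.eq_bot_iff]
      rintro u ⟨hu, hk⟩
      by_contra hu0
      have := hneg u hu hu0
      have hk : A u = 0 := hk
      simp [hk] at this
    have e := Submodule.finrank_sup_add_finrank_inf_eq W (LinearMap.ker (A : E →ₗ[ℝ] E))
    rw [hb, finrank_bot] at e
    have e2 := Submodule.finrank_mono (sup_le hW (le_sup_left :
      LinearMap.ker (A : E →ₗ[ℝ] E) ≤ _ ⊔ Submodule.span ℝ {w}))
    have e3 := Submodule.finrank_add_le_finrank_add_finrank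
      (LinearMap.ker (A : E →ₗ[ℝ] E)) (Submodule.span ℝ {w})
    rw [finrank_span_singleton hw] at e3
    have : Module.finrank ℝ W ≤ 1 := by omega
    exact_mod_cast this
  · apply le_sSup
    refine ⟨Submodule.span ℝ {w}, le_sup_right, inferInstance, ?_, ?_⟩
    · rw [finrank_span_singleton hw]; rfl
    · intro u hu hu0
      obtain ⟨c, rfl⟩ := Submodule.mem_span_singleton.1 hu
      have hc : c ≠ 0 := by rintro rfl; simp at hu0
      simp only [map_smul, real_inner_smul_left, real_inner_smul_right]
      have : 0 < c * c := mul_self_pos.2 hc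
      nlinarith

theorem aux_ker_le (A : E →L[ℝ] E) (hA : ∀ u v : E, ⟪A u, v⟫ = ⟪u, A v⟫) (w : E) :
    LinearMap.ker (A : E →ₗ[ℝ] E) ≤ LinearMap.ker (ellFunctional A w : E →ₗ[ℝ] ℝ) := by
  intro k hk
  have hk : A k = 0 := hk
  rw [aux_mem_H, hA, hk, inner_zero_right]

theorem aux_inf (A : E →L[ℝ] E) (hA : ∀ u v : E, ⟪A u, v⟫ = ⟪u, A v⟫) (w : E)
    (h : ⟪A w, w⟫ ≠ 0) :
    LinearMap.ker (ellFunctional A w : E →ₗ[ℝ] ℝ) ⊓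
      (LinearMap.ker (A : E →ₗ[ℝ] E) ⊔ Submodule.span ℝ {w}) =
    LinearMap.ker (A : E →ₗ[ℝ] E) := by
  apply le_antisymm
  · rintro u ⟨hu, hu2⟩
    obtain ⟨k, hk, y, hy, rfl⟩ := Submodule.mem_sup.1 hu2
    obtain ⟨c, rfl⟩ := Submodule.mem_span_singleton.1 hy
    have hkH := (aux_mem_H A w k).1 (aux_ker_le A hA w hk)
    have hu := (aux_mem_H A w _).1 hu
    rw [inner_add_right, hkH, real_inner_smul_right, zero_add] at hu
    have : c = 0 := by simpa [h] using hu
    simpa [this] using hk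
  · exact le_inf (aux_ker_le A hA w) le_sup_left

theorem nCorrection_mem_zero_one (A : E →L[ℝ] E)
    (hA : ∀ u v : E, ⟪A u, v⟫ = ⟪u, A v⟫)
    (hker : FiniteDimensional ℝ (LinearMap.ker (A : E →ₗ[ℝ] E))) (w : E) :
    nCorrection A w ∈ ({0, 1} : Set ℕ∞) ∧
      (0 < -⟪A w, w⟫ → nCorrection A w = 1) ∧
      (-⟪A w, w⟫ < 0 → nCorrection A w = 0) := by
  have hsub : ∀ m n : ℕ, ((m : ℕ∞) + n) - n = m := by
    intro m n
    exact_mod_cast congrArg (Nat.cast : ℕ → ℕ∞) (Nat.add_sub_cancel (n := m) (m := n))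
  have hn : nCorrection A w = morseIndexOn (fun u v => ⟪A u, v⟫)
      (LinearMap.ker (A : E →ₗ[ℝ] E) ⊔ Submodule.span ℝ {w})
      + (Module.finrank ℝ ↥(LinearMap.ker (ellFunctional A w : E →ₗ[ℝ] ℝ) ⊓
          (LinearMap.ker (A : E →ₗ[ℝ] E) ⊔ Submodule.span ℝ {w})) : ℕ∞)
      - (Module.finrank ℝ (LinearMap.ker (A : E →ₗ[ℝ] E)) : ℕ∞) := by
    unfold nCorrection
    rw [aux_perp A hA w, inf_eq_right.2 (aux_ker_le A hA w)]
  rcases lt_trichotomy ⟪A w, w⟫ 0 with h | h | h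
  · have : nCorrection A w = 1 := by
      rw [hn, aux_morse_one A hker w h, aux_inf A hA w h.ne]
      exact_mod_cast hsub 1 _
    refine ⟨by simp [this], fun _ => this, fun h' => by linarith⟩
  · refine ⟨?_, fun h' => by linarith, fun h' => by linarith⟩
    have hle : LinearMap.ker (A : E →ₗ[ℝ] E) ⊔ Submodule.span ℝ {w} ≤
        LinearMap.ker (ellFunctional A w : E →ₗ[ℝ] ℝ) := by
      refine sup_le (aux_ker_le A hA w) ?_
      rw [Submodule.span_singleton_le_iff_mem, aux_mem_H, h]
    rw [hn, aux_morse_zero A hA w h.ge, inf_eq_right.2 hle]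
    by_cases hw : A w = 0
    · have : LinearMap.ker (A : E →ₗ[ℝ] E) ⊔ Submodule.span ℝ {w} =
          LinearMap.ker (A : E →ₗ[ℝ] E) := by
        rw [sup_eq_left, Submodule.span_singleton_le_iff_mem]; exact hw
      rw [this]
      left
      exact_mod_cast hsub 0 _
    · have hw0 : w ≠ 0 := by rintro rfl; simp at hw
      have hb : LinearMap.ker (A : E →ₗ[ℝ] E) ⊓ Submodule.span ℝ {w} = ⊥ := by
        rw [Submodule.eq_bot_iff]
        rintro u ⟨hk, hu⟩
        obtain ⟨c, rfl⟩ := Submodule.mem_span_singleton.1 hu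
        have hk : A (c • w) = 0 := hk
        rw [map_smul, smul_eq_zero] at hk
        rcases hk with hk | hk
        · simp [hk]
        · exact absurd hk hw
      have e := Submodule.finrank_sup_add_finrank_inf_eq
        (LinearMap.ker (A : E →ₗ[ℝ] E)) (Submodule.span ℝ {w})
      rw [hb, finrank_bot, finrank_span_singleton hw0, add_zero] at e
      rw [e]
      right
      rw [zero_add, add_comm, Nat.cast_add]
      exact hsub 1 _
  · have : nCorrection A w = 0 := by
      rw [hn, aux_morse_zero A hA w h.le, aux_inf A hA w h.ne']
      exact_mod_cast hsub 0 _
    refine ⟨by simp [this], fun h' => by linarith, fun _ => this⟩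
end

section
/- Fix n ≥ 1 and let J = [[0, I_n],[−I_n, 0]] ∈ Matrix(2n,2n,ℝ). Let P, Q, R : ℝ → Matrix(n,n,ℝ) be continuous with P(t) symmetric positive definite and R(t) symmetric for every t, let T > 0, and define the block matrix B(t) := T·[[P(t)⁻¹, −P(t)⁻¹Q(t)], [−Q(t)ᵀP(t)⁻¹, Q(t)ᵀP(t)⁻¹Q(t) − R(t)]]. Let φ : ℝ → Matrix(2n,2n,ℝ) satisfy φ(0) = I and φ'(t) = J·B(t)·φ(t) for all t. Then for every s ∈ (0,1] and every nonzero u₀ ∈ ℝ^{2n} whose last n components vanish and such that the last n components of φ(s)·u₀ also vanish, one has ⟨B(s)·φ(s)·u₀, φ(s)·u₀⟩ > 0. In particular the crossing form in the s-direction is positive definite on the kernel of the Dirichlet boundary value problem, and its signature equals the dimension of that kernel. -/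
open Matrix

/-- The standard symplectic matrix `J = [[0, I],[−I, 0]]`. -/
noncomputable def symplJ (n : ℕ) : Matrix (Fin n ⊕ Fin n) (Fin n ⊕ Fin n) ℝ :=
  Matrix.fromBlocks 0 1 (-1) 0

lemma hasDerivAt_mul_entry {m : Type*} [Fintype m] {M N : ℝ → Matrix m m ℝ} {M' N' : Matrix m m ℝ}
    {t : ℝ} (hM : ∀ i j, HasDerivAt (fun s => M s i j) (M' i j) t)
    (hN : ∀ i j, HasDerivAt (fun s => N s i j) (N' i j) t) (i j : m) :
    HasDerivAt (fun s => (M s * N s) i j) ((M' * N t + M t * N') i j) t := by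
  simp only [Matrix.mul_apply, Matrix.add_apply, ← Finset.sum_add_distrib]
  exact HasDerivAt.fun_sum fun k _ => (hM i k).mul (hN k j)

/-- for the Hamiltonian coefficient matrix
`B(t) = T [[P⁻¹, −P⁻¹Q],[−QᵀP⁻¹, QᵀP⁻¹Q − R]]` with `P(t)` symmetric positive definite and
`R(t)` symmetric, and `φ` the fundamental solution of `u̇ = J B(t) u`, the crossing form in
the `s`-direction is positive on kernel elements of the Dirichlet boundary value problem:
for `s ∈ (0,1]` and `u₀ ≠ 0` with vanishing last `n` components such that `φ(s) u₀` also
has vanishing last `n` components, one has `⟨B(s) φ(s) u₀, φ(s) u₀⟩ > 0`. -/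
theorem crossing_form_positive {n : ℕ} (hn : 1 ≤ n)
    (P Q R : ℝ → Matrix (Fin n) (Fin n) ℝ)
    (hPcont : ∀ i j, Continuous fun t => P t i j)
    (hQcont : ∀ i j, Continuous fun t => Q t i j)
    (hRcont : ∀ i j, Continuous fun t => R t i j)
    (hP : ∀ t, (P t).PosDef) (hR : ∀ t, (R t).IsSymm)
    (T : ℝ) (hT : 0 < T)
    (B : ℝ → Matrix (Fin n ⊕ Fin n) (Fin n ⊕ Fin n) ℝ)
    (hB : ∀ t, B t = T • Matrix.fromBlocks
      (P t)⁻¹ (-((P t)⁻¹ * Q t))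
      (-((Q t)ᵀ * (P t)⁻¹)) ((Q t)ᵀ * (P t)⁻¹ * Q t - R t))
    (φ : ℝ → Matrix (Fin n ⊕ Fin n) (Fin n ⊕ Fin n) ℝ)
    (hφ0 : φ 0 = 1)
    (hφ : ∀ t, ∀ i j, HasDerivAt (fun s => φ s i j) ((symplJ n * B t * φ t) i j) t) :
    ∀ s ∈ Set.Ioc (0:ℝ) 1, ∀ u₀ : Fin n ⊕ Fin n → ℝ, u₀ ≠ 0 →
      (∀ i : Fin n, u₀ (Sum.inr i) = 0) →
      (∀ i : Fin n, (φ s).mulVec u₀ (Sum.inr i) = 0) →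
      0 < ((B s).mulVec ((φ s).mulVec u₀)) ⬝ᵥ ((φ s).mulVec u₀) := by
  have hJT : (symplJ n)ᵀ = - symplJ n := by
    simp [symplJ, Matrix.fromBlocks_transpose, Matrix.fromBlocks_neg]
  have hJJ : symplJ n * symplJ n = -1 := by
    rw [symplJ, Matrix.fromBlocks_multiply, ← Matrix.fromBlocks_one, Matrix.fromBlocks_neg]
    simp
  have hPT : ∀ t, ((P t)⁻¹)ᵀ = (P t)⁻¹ := fun t => by
    have h := (hP t).inv.isHermitian
    rw [Matrix.IsHermitian, Matrix.conjTranspose_eq_transpose_of_trivial] at h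
    exact h
  have hBT : ∀ t, (B t)ᵀ = B t := fun t => by
    have h2 : (R t)ᵀ = R t := hR t
    rw [hB, Matrix.transpose_smul, Matrix.fromBlocks_transpose]
    simp [Matrix.transpose_mul, hPT, h2, Matrix.mul_assoc]
  have hder : ∀ t i j, HasDerivAt (fun s => ((φ s)ᵀ * (symplJ n * φ s)) i j) 0 t := by
    intro t i j
    have h1 := hasDerivAt_mul_entry (M := fun _ => symplJ n) (N := φ) (M' := 0)
      (fun i j => by simpa using hasDerivAt_const t (symplJ n i j)) (hφ t)
    have h2 := hasDerivAt_mul_entry (M := fun s => (φ s)ᵀ) (N := fun s => symplJ n * φ s)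
      (M' := (symplJ n * B t * φ t)ᵀ) (fun i j => hφ t j i) h1 i j
    convert h2 using 1
    have e : (symplJ n * B t * φ t)ᵀ * (symplJ n * φ t) = (φ t)ᵀ * (B t * φ t) := by
      rw [Matrix.transpose_mul, Matrix.transpose_mul, hBT, hJT]
      calc _ = -((φ t)ᵀ * (B t * ((symplJ n * symplJ n) * φ t))) := by
            simp [Matrix.mul_assoc]
        _ = _ := by rw [hJJ]; simp
    have e2 : symplJ n * (symplJ n * B t * φ t) = -(B t * φ t) := by
      rw [Matrix.mul_assoc, ← Matrix.mul_assoc, hJJ]; simp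
    simp only [e, e2]
    simp
  intro s _ u₀ hu h0 hs
  have hsym : (φ s)ᵀ * (symplJ n * φ s) = symplJ n := by
    ext i j
    have := is_const_of_deriv_eq_zero (fun t => (hder t i j).differentiableAt)
      (fun t => (hder t i j).deriv) s 0
    simpa [hφ0] using this
  have hne : (φ s).mulVec u₀ ≠ 0 := by
    intro hz
    apply hu
    have h1 : (symplJ n).mulVec u₀ = 0 := by
      rw [← hsym, ← Matrix.mulVec_mulVec, ← Matrix.mulVec_mulVec, hz]; simp
    have h2 : (symplJ n * symplJ n).mulVec u₀ = 0 := by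
      rw [← Matrix.mulVec_mulVec, h1]; simp
    rw [hJJ] at h2
    simpa [Matrix.neg_mulVec] using h2
  generalize (φ s).mulVec u₀ = v at hs hne
  obtain ⟨x, rfl⟩ : ∃ x : Fin n → ℝ, v = Sum.elim x 0 :=
    ⟨v ∘ Sum.inl, by ext (i | i) <;> simp [hs]⟩
  have hx : x ≠ 0 := by
    rintro rfl
    apply hne
    ext (i | i) <;> simp
  have hpos := (hP s).inv.dotProduct_mulVec_pos hx
  rw [hB, Matrix.smul_mulVec, smul_dotProduct, Matrix.fromBlocks_mulVec]
  refine mul_pos hT ?_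
  rw [dotProduct_comm]
  simpa [dotProduct, Fintype.sum_sum_type] using hpos
end

section
/- Fix n ≥ 1 and let J = [[0, I_n],[−I_n, 0]]. Let B : ℝ → Matrix(2n,2n,ℝ) be continuous with B(t) symmetric for all t, let B' : ℝ → Matrix(2n,2n,ℝ) be continuous with B'(t) symmetric for all t, and let φ, ψ : ℝ → Matrix(2n,2n,ℝ) satisfy: φ(0) = I, φ'(t) = J·B(t)·φ(t) for all t; ψ(0) = 0, ψ'(t) = J·B(t)·ψ(t) + J·B'(t)·φ(t) for all t (so ψ is the derivative of the fundamental solution with respect to a parameter σ, B' being the σ-derivative of the coefficient). Then for all u₀, v₀ ∈ ℝ^{2n}: ∫₀¹ ⟨B'(t)·φ(t)·u₀, φ(t)·v₀⟩ dt = ⟨ −J·φ(1)⁻¹·ψ(1)·u₀, v₀ ⟩. -/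
open Matrix MeasureTheory intervalIntegral

theorem symplJ_tr (n : ℕ) : (symplJ n)ᵀ = -symplJ n := by
  simp [symplJ, Matrix.fromBlocks_transpose, Matrix.fromBlocks_neg]

theorem symplJ_sq (n : ℕ) : symplJ n * symplJ n = -1 := by
  simp [symplJ, Matrix.fromBlocks_multiply, ← Matrix.fromBlocks_one, Matrix.fromBlocks_neg]

theorem entry_mul {m : Type*} [Fintype m] (A D : ℝ → Matrix m m ℝ) (A' D' : Matrix m m ℝ) (t : ℝ)
    (hA : ∀ i j, HasDerivAt (fun s => A s i j) (A' i j) t)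
    (hD : ∀ i j, HasDerivAt (fun s => D s i j) (D' i j) t) (i j : m) :
    HasDerivAt (fun s => (A s * D s) i j) ((A' * D t + A t * D') i j) t := by
  simp only [Matrix.mul_apply, Matrix.add_apply, ← Finset.sum_add_distrib]
  exact HasDerivAt.fun_sum fun k _ => (hA i k).mul (hD k j)

theorem entry_tri {m : Type*} [Fintype m] (A D : ℝ → Matrix m m ℝ) (A' D' C : Matrix m m ℝ) (t : ℝ)
    (hA : ∀ i j, HasDerivAt (fun s => A s i j) (A' i j) t)
    (hD : ∀ i j, HasDerivAt (fun s => D s i j) (D' i j) t) (i j : m) :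
    HasDerivAt (fun s => ((A s)ᵀ * (C * D s)) i j)
      ((A'ᵀ * (C * D t) + (A t)ᵀ * (C * D')) i j) t := by
  refine entry_mul (fun s => (A s)ᵀ) (fun s => C * D s) _ _ t (fun i j => hA j i) ?_ i j
  intro i j
  have := entry_mul (fun _ => C) D 0 D' t (fun i j => by simpa using hasDerivAt_const t (C i j)) hD i j
  simpa using this

/-- let `φ` be the fundamental solution of `u̇ = J B(t) u` and `ψ` the
solution of the variational equation `ψ̇ = J B ψ + J B' φ`, `ψ(0) = 0` (the parameter
derivative of the fundamental solution). Then for all `u₀, v₀`: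
`∫₀¹ ⟨B'(t) φ(t) u₀, φ(t) v₀⟩ dt = ⟨−J φ(1)⁻¹ ψ(1) u₀, v₀⟩`. -/
theorem crossing_form_endpoint_identity {n : ℕ} (hn : 1 ≤ n)
    (B B' : ℝ → Matrix (Fin n ⊕ Fin n) (Fin n ⊕ Fin n) ℝ)
    (hBcont : ∀ i j, Continuous fun t => B t i j)
    (hB'cont : ∀ i j, Continuous fun t => B' t i j)
    (hBsymm : ∀ t, (B t).IsSymm)
    (hB'symm : ∀ t, (B' t).IsSymm)
    (φ ψ : ℝ → Matrix (Fin n ⊕ Fin n) (Fin n ⊕ Fin n) ℝ)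
    (hφ0 : φ 0 = 1)
    (hφ : ∀ t, ∀ i j, HasDerivAt (fun s => φ s i j) ((symplJ n * B t * φ t) i j) t)
    (hψ0 : ψ 0 = 0)
    (hψ : ∀ t, ∀ i j, HasDerivAt (fun s => ψ s i j)
      ((symplJ n * B t * ψ t + symplJ n * B' t * φ t) i j) t) :
    ∀ u₀ v₀ : Fin n ⊕ Fin n → ℝ,
      (∫ t in (0:ℝ)..1, ((B' t).mulVec ((φ t).mulVec u₀)) ⬝ᵥ ((φ t).mulVec v₀))
        = ((-(symplJ n) * (φ 1)⁻¹ * ψ 1).mulVec u₀) ⬝ᵥ v₀ := by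
  intro u₀ v₀
  have hJJ : ∀ X : Matrix (Fin n ⊕ Fin n) (Fin n ⊕ Fin n) ℝ, symplJ n * (symplJ n * X) = -X := by
    intro X
    rw [← Matrix.mul_assoc, symplJ_sq]; simp
  have h1 : ∀ t i j, HasDerivAt (fun s => ((φ s)ᵀ * (symplJ n * φ s)) i j) 0 t := by
    intro t i j
    convert entry_tri φ φ _ _ (symplJ n) t (hφ t) (hφ t) i j using 1
    simp [Matrix.transpose_mul, (hBsymm t).eq, symplJ_tr, Matrix.mul_assoc, hJJ]
  have h2 : ∀ t i j, HasDerivAt (fun s => ((φ s)ᵀ * (symplJ n * ψ s)) i j)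
      ((-((φ t)ᵀ * (B' t * φ t))) i j) t := by
    intro t i j
    convert entry_tri φ ψ _ _ (symplJ n) t (hφ t) (hψ t) i j using 1
    simp [Matrix.transpose_mul, (hBsymm t).eq, symplJ_tr, Matrix.mul_assoc, hJJ, Matrix.mul_add]
  have h3 : (φ 1)ᵀ * (symplJ n * φ 1) = symplJ n := by
    ext i j
    have := is_const_of_deriv_eq_zero (fun t => (h1 t i j).differentiableAt)
      (fun t => (h1 t i j).deriv) 1 0
    simpa [hφ0] using this
  have hinv : (-(symplJ n * ((φ 1)ᵀ * symplJ n))) * φ 1 = 1 := by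
    rw [Matrix.neg_mul, Matrix.mul_assoc, Matrix.mul_assoc, h3, symplJ_sq, neg_neg]
  have hE : -(symplJ n) * (φ 1)⁻¹ * ψ 1 = -((φ 1)ᵀ * (symplJ n * ψ 1)) := by
    rw [Matrix.inv_eq_left_inv hinv]
    simp [Matrix.mul_assoc, hJJ]
  have hφc : ∀ i j, Continuous fun t => φ t i j := fun i j =>
    continuous_iff_continuousAt.2 fun t => (hφ t i j).continuousAt
  have hφm : Continuous φ := continuous_pi fun i => continuous_pi fun j => hφc i j
  have hBm : Continuous B' := continuous_pi fun i => continuous_pi fun j => hB'cont i j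
  have h4 : ∀ t, HasDerivAt (fun s => ((-((φ s)ᵀ * (symplJ n * ψ s))).mulVec u₀) ⬝ᵥ v₀)
      (((B' t).mulVec ((φ t).mulVec u₀)) ⬝ᵥ ((φ t).mulVec v₀)) t := by
    intro t
    have e : ((B' t).mulVec ((φ t).mulVec u₀)) ⬝ᵥ ((φ t).mulVec v₀)
        = (((φ t)ᵀ * (B' t * φ t)).mulVec u₀) ⬝ᵥ v₀ := by
      rw [Matrix.dotProduct_mulVec, ← Matrix.mulVec_transpose, Matrix.mulVec_mulVec,
        Matrix.mulVec_mulVec, Matrix.mul_assoc]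
    rw [e]
    simp only [Matrix.mulVec, dotProduct]
    refine HasDerivAt.fun_sum fun i _ => HasDerivAt.mul_const (HasDerivAt.fun_sum fun j _ =>
      HasDerivAt.mul_const ?_ _) _
    simpa using (h2 t i j).fun_neg
  rw [intervalIntegral.integral_eq_sub_of_hasDerivAt (fun t _ => h4 t), hE]
  · simp [hψ0]
  · apply Continuous.intervalIntegrable
    exact (hBm.matrix_mulVec (hφm.matrix_mulVec continuous_const)).dotProduct
      (hφm.matrix_mulVec continuous_const)
end

section
/- Let H be a real Hilbert space and 𝒜 : ℝ × ℝ → (H →L H) a continuously differentiable family of bounded operators such that each 𝒜(σ,s) is self-adjoint (⟨𝒜(σ,s)u, v⟩ = ⟨u, 𝒜(σ,s)v⟩ for all u,v). Fix (σ*, s*) and suppose ker 𝒜(σ*,s*) is k-dimensional with basis z₁,…,z_k and that the range of 𝒜(σ*,s*) is closed. Then there exist a neighborhood N of (σ*,s*) and a continuously differentiable map M : N → Matrix(k,k,ℝ) such that: (i) for every (σ,s) ∈ N, ker 𝒜(σ,s) ≠ {0} if and only if det M(σ,s) = 0; (ii) M(σ*,s*) = 0 (in particular det M(σ*,s*) =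 0); (iii) ∂M_{ij}/∂σ (σ*,s*) = ⟨ ∂𝒜/∂σ (σ*,s*) z_i, z_j ⟩ and ∂M_{ij}/∂s (σ*,s*) = ⟨ ∂𝒜/∂s (σ*,s*) z_i, z_j ⟩ for all i,j. -/
open scoped RealInnerProductSpace

/-- Lyapunov–Schmidt reduction: for a `C¹` two-parameter family
`𝒜(σ,s)` of bounded self-adjoint operators on a real Hilbert space with `k`-dimensional
kernel and closed range at `(σ*,s*)`, there is a neighborhood `N` of `(σ*,s*)` and a `C¹`
matrix-valued map `M` on `N` detecting degeneracy (`ker 𝒜(σ,s) ≠ 0 ↔ det M(σ,s) = 0`),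
with `M(σ*,s*) = 0` and partial derivatives at `(σ*,s*)` given by pairing the partial
derivatives of `𝒜` against a basis `z₁,…,z_k` of the kernel. -/
theorem lyapunov_schmidt_reduction
    {H : Type*} [NormedAddCommGroup H] [InnerProductSpace ℝ H] [CompleteSpace H]
    (𝒜 : ℝ × ℝ → (H →L[ℝ] H))
    (h𝒜 : ContDiff ℝ 1 𝒜)
    (hsa : ∀ (p : ℝ × ℝ) (u v : H), ⟪𝒜 p u, v⟫ = ⟪u, 𝒜 p v⟫)
    (σstar sstar : ℝ) (k : ℕ) (z : Fin k → H)
    (hz : ∀ i, 𝒜 (σstar, sstar) (z i) = 0)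
    (hzind : LinearIndependent ℝ z)
    (hzspan : Submodule.span ℝ (Set.range z) = LinearMap.ker (𝒜 (σstar, sstar) : H →ₗ[ℝ] H))
    (hclosed : IsClosed (Set.range ⇑(𝒜 (σstar, sstar)))) :
    ∃ N ∈ nhds ((σstar, sstar) : ℝ × ℝ), ∃ M : ℝ × ℝ → Matrix (Fin k) (Fin k) ℝ,
      (∀ i j, ContDiffOn ℝ 1 (fun p => M p i j) N) ∧
      (∀ p ∈ N, (LinearMap.ker (𝒜 p : H →ₗ[ℝ] H) ≠ ⊥ ↔ (M p).det = 0)) ∧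
      M (σstar, sstar) = 0 ∧
      (∀ i j : Fin k,
        HasDerivAt (fun σ => M (σ, sstar) i j)
          ⟪(fderiv ℝ 𝒜 (σstar, sstar) (1, 0)) (z i), z j⟫ σstar ∧
        HasDerivAt (fun s => M (σstar, s) i j)
          ⟪(fderiv ℝ 𝒜 (σstar, sstar) (0, 1)) (z i), z j⟫ sstar) := by
  classical
  set p0 : ℝ × ℝ := (σstar, sstar) with hp0
  set A0 := 𝒜 p0 with hA0
  set K : Submodule ℝ H := Submodule.span ℝ (Set.range z) with hK
  have hfin : FiniteDimensional ℝ K := FiniteDimensional.span_of_finite ℝ (Set.finite_range z)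
  set Q : H →L[ℝ] H := K.starProjection with hQ
  have hzK : ∀ i, z i ∈ K := fun i => Submodule.subset_span ⟨i, rfl⟩
  have hKA : ∀ u, u ∈ K ↔ A0 u = 0 := by
    intro u; rw [hzspan]; exact LinearMap.mem_ker
  have hQmem : ∀ u, Q u ∈ K := fun u => K.starProjection_apply_mem u
  have hQid : ∀ u ∈ K, Q u = u := fun u hu => Submodule.starProjection_eq_self_iff.2 hu
  have hQsym : ∀ u v : H, ⟪Q u, v⟫ = ⟪u, Q v⟫ := fun u v => K.starProjection_isSymmetric u v
  set T : ℝ × ℝ → (H →L[ℝ] H) := fun p => 𝒜 p + Q with hT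
  have hTapp : ∀ p u, T p u = 𝒜 p u + Q u := fun p u => rfl
  have hTsym : ∀ p (u v : H), ⟪T p u, v⟫ = ⟪u, T p v⟫ := by
    intro p u v
    rw [hTapp, hTapp, inner_add_left, inner_add_right, hsa, hQsym]
  have hT0z : ∀ i, T p0 (z i) = z i := by
    intro i
    rw [hTapp, hQid _ (hzK i), hz i, zero_add]
  have hTC : ContDiff ℝ 1 T := h𝒜.add contDiff_const
  -- bijectivity
  have hinj : Function.Injective (T p0) := by
    rw [injective_iff_map_eq_zero]
    intro u hu
    have h1 : ⟪T p0 u, Q u⟫ = 0 := by rw [hu, inner_zero_left]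
    rw [hTapp, inner_add_left, hsa p0 u (Q u), (hKA _).1 (hQmem u), inner_zero_right, zero_add,
      inner_self_eq_zero] at h1
    rw [hTapp, h1, add_zero] at hu
    rw [← hQid u ((hKA u).2 hu), h1]
  have hrange : ∀ y ∈ Kᗮ, ∃ v, A0 v = y := by
    intro y hy
    set R : Submodule ℝ H := LinearMap.range (A0 : H →ₗ[ℝ] H) with hR
    have hRc : IsClosed (R : Set H) := by
      have : (R : Set H) = Set.range ⇑A0 := by ext; simp [hR]
      rw [this]; exact hclosed
    have : CompleteSpace R := hRc.completeSpace_coe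
    have hRK : Rᗮ ≤ K := by
      intro w hw
      rw [hKA]
      have := (Submodule.mem_orthogonal R w).1 hw (A0 (A0 w)) ⟨A0 w, rfl⟩
      rw [hsa p0 (A0 w) w, inner_self_eq_zero] at this
      exact this
    have h2 : y ∈ Rᗮᗮ := Submodule.orthogonal_le hRK hy
    rw [Submodule.orthogonal_orthogonal] at h2
    exact h2
  have hsurj : Function.Surjective (T p0) := by
    intro y
    obtain ⟨v, hv⟩ := hrange (y - Q y) (K.sub_starProjection_mem_orthogonal y)
    refine ⟨v - Q v + Q y, ?_⟩
    have e1 : A0 (Q v) = 0 := (hKA _).1 (hQmem v)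
    have e2 : A0 (Q y) = 0 := (hKA _).1 (hQmem y)
    rw [hTapp, ← hA0]
    simp only [map_add, map_sub, e1, e2, hv, hQid _ (hQmem v), hQid _ (hQmem y)]
    abel
  have hunit : IsUnit (T p0) := ContinuousLinearMap.isUnit_iff_bijective.2 ⟨hinj, hsurj⟩
  set S : ℝ × ℝ → (H →L[ℝ] H) := fun p => Ring.inverse (T p) with hS
  have hTS : ∀ p, IsUnit (T p) → ∀ u, T p (S p u) = u := by
    intro p hp u
    have := Ring.mul_inverse_cancel _ hp
    exact congrArg (fun F : H →L[ℝ] H => F u) this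
  have hST : ∀ p, IsUnit (T p) → ∀ u, S p (T p u) = u := by
    intro p hp u
    have := Ring.inverse_mul_cancel _ hp
    exact congrArg (fun F : H →L[ℝ] H => F u) this
  have hS0z : ∀ i, S p0 (z i) = z i := by
    intro i
    have := hST p0 hunit (z i)
    rwa [hT0z] at this
  have hSsym0 : ∀ u v : H, ⟪S p0 u, v⟫ = ⟪u, S p0 v⟫ := by
    intro u v
    conv_lhs => rw [← hTS p0 hunit v]
    rw [← hTsym, hTS p0 hunit]
  have hSC : ∀ p, IsUnit (T p) → ContDiffAt ℝ 1 S p := by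
    intro p hp
    obtain ⟨x, hx⟩ := hp
    have h1 : ContDiffAt ℝ 1 Ring.inverse (T p) := by
      rw [← hx]; exact contDiffAt_ringInverse ℝ x
    exact h1.comp p hTC.contDiffAt
  have hSd : ∀ v i j, ⟪fderiv ℝ S p0 v (z i), z j⟫ = - ⟪fderiv ℝ 𝒜 p0 v (z i), z j⟫ := by
    intro v i j
    obtain ⟨x, hx⟩ := hunit
    have hxi : ((x⁻¹ : (H →L[ℝ] H)ˣ) : H →L[ℝ] H) = S p0 := by
      rw [hS]; simp only; rw [← hx, Ring.inverse_unit]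
    have h1 := hasFDerivAt_ringInverse (𝕜 := ℝ) x
    have h2 : HasFDerivAt T (fderiv ℝ 𝒜 p0) p0 :=
      ((h𝒜.differentiable one_ne_zero) p0).hasFDerivAt.add_const Q
    rw [hx] at h1
    have h3 := (h1.comp p0 h2).fderiv
    have h4 : fderiv ℝ S p0 v = - (S p0 * (fderiv ℝ 𝒜 p0 v) * S p0) := by
      have : fderiv ℝ S p0 = _ := h3
      rw [this, ← hxi]; rfl
    rw [h4]
    change ⟪-(S p0 (fderiv ℝ 𝒜 p0 v (S p0 (z i)))), z j⟫ = _
    rw [inner_neg_left, hSsym0, hS0z, hS0z]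
  have hSdiff : HasFDerivAt S (fderiv ℝ S p0) p0 :=
    ((hSC p0 hunit).differentiableAt one_ne_zero).hasFDerivAt
  refine ⟨{p | IsUnit (T p)}, ?_, fun p => Matrix.of fun i j => ⟪z i, z j⟫ - ⟪S p (z i), z j⟫,
    ?_, ?_, ?_, ?_⟩
  · exact (Units.isOpen.preimage hTC.continuous).mem_nhds hunit
  · intro i j p hp
    refine ContDiffAt.contDiffWithinAt ?_
    simp only [Matrix.of_apply]
    exact contDiffAt_const.sub
      (((hSC p hp).clm_apply contDiffAt_const).inner ℝ contDiffAt_const)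
  · intro p hp
    have hp : IsUnit (T p) := hp
    -- basic identity
    have key : ∀ c : Fin k → ℝ, ∀ j,
        (Matrix.vecMul c (Matrix.of fun i j => ⟪z i, z j⟫ - ⟪S p (z i), z j⟫)) j
          = ⟪𝒜 p (S p (∑ i, c i • z i)), z j⟫ := by
      intro c j
      have h1 : 𝒜 p (S p (∑ i, c i • z i)) = (∑ i, c i • z i) - Q (S p (∑ i, c i • z i)) := by
        rw [eq_sub_iff_add_eq, ← hTapp, hTS p hp]
      rw [h1, inner_sub_left, hQsym, hQid _ (hzK j)]
      simp only [map_sum, map_smul, sum_inner, real_inner_smul_left, Matrix.vecMul, dotProduct,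
        Matrix.of_apply, mul_sub, Finset.sum_sub_distrib]
    rw [← Matrix.exists_vecMul_eq_zero_iff, Submodule.ne_bot_iff]
    constructor
    · rintro ⟨u, hu, hu0⟩
      have hu : 𝒜 p u = 0 := hu
      have h1 : T p u = Q u := by rw [hTapp, hu, zero_add]
      obtain ⟨c, hc⟩ := (Submodule.mem_span_range_iff_exists_fun ℝ).1 (hQmem u)
      have h2 : S p (∑ i, c i • z i) = u := by rw [hc, ← h1, hST p hp]
      refine ⟨c, ?_, ?_⟩
      · rintro rfl
        apply hu0
        rw [← h2]; simp
      · funext j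
        rw [key, h2, hu, inner_zero_left]; rfl
    · rintro ⟨c, hc0, hc⟩
      refine ⟨S p (∑ i, c i • z i), ?_, ?_⟩
      · change 𝒜 p (S p (∑ i, c i • z i)) = 0
        set y := 𝒜 p (S p (∑ i, c i • z i)) with hy
        have hyK : y ∈ K := by
          have h1 : y = (∑ i, c i • z i) - Q (S p (∑ i, c i • z i)) := by
            rw [eq_sub_iff_add_eq, hy, ← hTapp, hTS p hp]
          rw [h1]
          exact K.sub_mem (K.sum_mem fun i _ => K.smul_mem _ (hzK i)) (hQmem _)
        obtain ⟨d, hd⟩ := (Submodule.mem_span_range_iff_exists_fun ℝ).1 hyK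
        have h0 : ∀ j, ⟪y, z j⟫ = 0 := by
          intro j; rw [← key c j, hc]; rfl
        have : ⟪y, y⟫ = 0 := by
          nth_rw 2 [← hd]
          simp [inner_sum, real_inner_smul_right, h0]
        exact inner_self_eq_zero.1 this
      · intro h
        apply hc0
        have h1 := hTS p hp (∑ i, c i • z i)
        rw [h, map_zero] at h1
        funext i
        exact Fintype.linearIndependent_iff.1 hzind c h1.symm i
  · ext i j
    simp [hS0z]
  · intro i j
    have hd : ∀ (γ : ℝ → ℝ × ℝ) (v : ℝ × ℝ) (t : ℝ), γ t = p0 → HasDerivAt γ v t →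
        HasDerivAt (fun t => ⟪z i, z j⟫ - ⟪S (γ t) (z i), z j⟫)
          ⟪fderiv ℝ 𝒜 p0 v (z i), z j⟫ t := by
      intro γ v t h0 hγ
      have h1 : HasDerivAt (fun t => S (γ t)) (fderiv ℝ S p0 v) t := by
        rw [← h0] at hSdiff ⊢
        exact hSdiff.comp_hasDerivAt t hγ
      have h2 := (h1.clm_apply (hasDerivAt_const t (z i))).inner ℝ (hasDerivAt_const t (z j))
      have h3 := h2.const_sub ⟪z i, z j⟫
      rw [map_zero, inner_zero_right, add_zero, zero_add, hSd, neg_neg] at h3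
      exact h3
    exact ⟨hd (fun σ => (σ, sstar)) (1, 0) σstar rfl
        ((hasDerivAt_id _).prodMk (hasDerivAt_const _ _)),
      hd (fun s => (σstar, s)) (0, 1) sstar rfl
        ((hasDerivAt_const _ _).prodMk (hasDerivAt_id _))⟩
end
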